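/- arXiv:2303.01648 — 13 statements merged into one kernel-verified Lean document; each statement's English description precedes it below -/
import Mathlib

section
/- Suppose (φ,y) is a feasible strategy, with traffic rates t and marginals q, that satisfies the modified optimality condition with the marginal quantities δ_i(k). Then for every feasible strategy (φ†,y†) with traffic rates t†, the total costs satisfy T(φ†,y†) − T(φ,y) ≥ Σ_{i∈V} Σ_{k∈C} δ_i(k)·(y_i(k) − y†_i(k))·(t†_i(k) − t_i(k)). -/
open Finset

noncomputable section

variable {V C : Type*}

/-- Total response flow on link `(a,b)`: `F_{ab} = ∑_k f_{ab}(k)` where `f_{ab}(k) = t_b(k)·φ_{ba}(k)`. -/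
def linkFlow [Fintype C] (φ : V → V → C → ℝ) (t : V → C → ℝ) (a b : V) : ℝ :=
  ∑ k, t b k * φ b a k

/-- Cache size `Y_i = ∑_k y_i(k)`. -/
def cacheSize [Fintype C] (y : V → C → ℝ) (i : V) : ℝ :=
  ∑ k, y i k

/-- Total cost `T(φ,y) = ∑_{(i,j)∈E} D_ij(F_ij) + ∑_i B_i(Y_i)`. -/
def totalCost [Fintype V] [Fintype C] (E : V → V → Prop) [DecidableRel E]
    (D : V → V → ℝ → ℝ) (B : V → ℝ → ℝ)
    (φ : V → V → C → ℝ) (y : V → C → ℝ) (t : V → C → ℝ) : ℝ :=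
  (∑ a, ∑ b, if E a b then D a b (linkFlow φ t a b) else 0) + ∑ i, B i (cacheSize y i)

/-- Feasibility of joint routing/caching strategies. -/
def Feasible [Fintype V] [DecidableEq V] (E : V → V → Prop) (S : C → Finset V)
    (φ : V → V → C → ℝ) (y : V → C → ℝ) : Prop :=
  (∀ i j k, 0 ≤ φ i j k ∧ φ i j k ≤ 1) ∧
  (∀ i j k, ¬ E i j → φ i j k = 0) ∧
  (∀ i k, 0 ≤ y i k ∧ y i k ≤ 1) ∧
  (∀ i k, y i k + ∑ j, φ i j k = if i ∈ S k then 0 else 1)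

/-- Traffic equations `t_i(k) = r_i(k) + ∑_j t_j(k) φ_{ji}(k)`, with `t ≥ 0`. -/
def TrafficEq [Fintype V] (r : V → C → ℝ) (φ : V → V → C → ℝ) (t : V → C → ℝ) : Prop :=
  ∀ i k, 0 ≤ t i k ∧ t i k = r i k + ∑ j, t j k * φ j i k

/-- Marginal recursion `q_i(k) = ∑_{j ∈ N(i)} φ_ij(k) (D'_ji(F_ji) + q_j(k))`. -/
def MarginalEq [Fintype V] [Fintype C] (E : V → V → Prop) [DecidableRel E]
    (D' : V → V → ℝ → ℝ) (φ : V → V → C → ℝ) (t : V → C → ℝ) (q : V → C → ℝ) : Prop :=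
  ∀ i k, q i k = ∑ j, if E i j then φ i j k * (D' j i (linkFlow φ t j i) + q j k) else 0

/-- `δ_i(k)` is the minimum marginal cost, with the convention `B'_i(Y_i)/t_i(k) = +∞` when `t_i(k) = 0`. -/
def IsDelta [Fintype V] [Fintype C] (E : V → V → Prop)
    (D' : V → V → ℝ → ℝ) (B' : V → ℝ → ℝ)
    (φ : V → V → C → ℝ) (y : V → C → ℝ) (t : V → C → ℝ) (q : V → C → ℝ)
    (δ : V → C → ℝ) : Prop :=
  ∀ i k,
    (0 < t i k → δ i k = min (B' i (cacheSize y i) / t i k)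
      (sInf {x : ℝ | ∃ j, E i j ∧ x = D' j i (linkFlow φ t j i) + q j k})) ∧
    (t i k = 0 → δ i k = sInf {x : ℝ | ∃ j, E i j ∧ x = D' j i (linkFlow φ t j i) + q j k})

/-- Caching part of the modified optimality condition. -/
def CacheCond [Fintype C] (B' : V → ℝ → ℝ) (y : V → C → ℝ) (t : V → C → ℝ)
    (δ : V → C → ℝ) : Prop :=
  ∀ i k, (0 < y i k → B' i (cacheSize y i) = t i k * δ i k) ∧
    (y i k = 0 → t i k * δ i k ≤ B' i (cacheSize y i))

/-- Routing part of the modified optimality condition. -/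
def RouteCond [Fintype C] (E : V → V → Prop) (D' : V → V → ℝ → ℝ)
    (φ : V → V → C → ℝ) (t : V → C → ℝ) (q : V → C → ℝ) (δ : V → C → ℝ) : Prop :=
  ∀ i k, ∀ j, E i j →
    (0 < φ i j k → D' j i (linkFlow φ t j i) + q j k = δ i k) ∧
    (φ i j k = 0 → δ i k ≤ D' j i (linkFlow φ t j i) + q j k)

/-- Link costs: continuously differentiable (with derivative `D'`), nondecreasing, convex, `D(0)=0`, nonnegative. -/
def LinkCostReg (D D' : V → V → ℝ → ℝ) : Prop :=
  ∀ a b, (∀ x, HasDerivAt (D a b) (D' a b x) x) ∧ MonotoneOn (D a b) (Set.Ici 0) ∧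
    ConvexOn ℝ (Set.Ici 0) (D a b) ∧ D a b 0 = 0 ∧ ∀ x, 0 ≤ x → 0 ≤ D a b x

/-- Cache deployment costs: continuously differentiable (with derivative `B'`), nondecreasing, convex, `B(0)=0`, nonnegative. -/
def CacheCostReg (B B' : V → ℝ → ℝ) : Prop :=
  ∀ i, (∀ x, HasDerivAt (B i) (B' i x) x) ∧ MonotoneOn (B i) (Set.Ici 0) ∧
    ConvexOn ℝ (Set.Ici 0) (B i) ∧ B i 0 = 0 ∧ ∀ x, 0 ≤ x → 0 ≤ B i x

/-- Loop-free routing: for every item, the support digraph of `φ` is acyclic. -/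
def LoopFree (φ : V → V → C → ℝ) : Prop :=
  ∀ k, ¬ ∃ (n : ℕ) (c : ℕ → V), 0 < n ∧ c 0 = c n ∧ ∀ l < n, 0 < φ (c l) (c (l + 1)) k

theorem ConvexOn.hasDerivAt_mul_sub_le {s : Set ℝ} {f : ℝ → ℝ} {f' x z : ℝ}
    (hf : ConvexOn ℝ s f) (hx : x ∈ s) (hz : z ∈ s) (hd : HasDerivAt f f' x) :
    f' * (z - x) ≤ f z - f x := by
  rcases lt_trichotomy x z with h | rfl | h
  · have := hf.le_slope_of_hasDerivAt hx hz h hd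
    rwa [slope_def_field, le_div_iff₀ (sub_pos.2 h)] at this
  · simp
  · have := hf.slope_le_of_hasDerivAt hz hx h hd
    rw [slope_def_field, div_le_iff₀ (sub_pos.2 h)] at this
    linarith

/-- Weighting the traffic equations by a potential `p`. -/
theorem TrafficEq.sum_mul [Fintype V] {r : V → C → ℝ} {φ : V → V → C → ℝ} {t : V → C → ℝ}
    (h : TrafficEq r φ t) (p : V → C → ℝ) (k : C) :
    ∑ i, ∑ j, p j k * (t i k * φ i j k) = ∑ i, p i k * (t i k - r i k) := by
  rw [sum_comm]
  refine sum_congr rfl fun j _ => ?_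
  rw [← mul_sum]
  congr 1
  linarith [(h j k).2]

theorem sum_link_marginal [Fintype V] [Fintype C] (w : V → V → ℝ)
    (φ : V → V → C → ℝ) (t : V → C → ℝ) :
    ∑ a, ∑ b, w a b * linkFlow φ t a b = ∑ k, ∑ i, ∑ j, w j i * (t i k * φ i j k) := by
  simp only [linkFlow, mul_sum]
  rw [sum_comm, sum_comm_cycle, sum_comm_cycle]

theorem linkFlow_nonneg [Fintype C] {φ : V → V → C → ℝ} {t : V → C → ℝ}
    (hφ : ∀ i j k, 0 ≤ φ i j k) (ht : ∀ i k, 0 ≤ t i k) (a b : V) : 0 ≤ linkFlow φ t a b :=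
  sum_nonneg fun k _ => mul_nonneg (ht b k) (hφ b a k)

theorem linkFlow_eq_zero [Fintype C] {φ : V → V → C → ℝ} {a b : V}
    (h : ∀ k, φ b a k = 0) (t : V → C → ℝ) : linkFlow φ t a b = 0 := by
  simp [linkFlow, h]

theorem cacheSize_nonneg [Fintype C] {y : V → C → ℝ} (hy : ∀ i k, 0 ≤ y i k) (i : V) :
    0 ≤ cacheSize y i :=
  sum_nonneg fun k _ => hy i k

/-- Theorem 3, bounded gap: if `(φ,y)` satisfies the modified optimality
condition, then for any feasible `(φ†,y†)`,
`T(φ†,y†) − T(φ,y) ≥ ∑_i ∑_k δ_i(k) (y_i(k) − y†_i(k)) (t†_i(k) − t_i(k))`. -/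
theorem modified_condition_bounded_gap
    {V C : Type*} [Fintype V] [Fintype C] [DecidableEq V]
    (E : V → V → Prop) [DecidableRel E] (hEsymm : ∀ i j, E i j → E j i)
    (hN : ∀ i, ∃ j, E i j)
    (S : C → Finset V) (r : V → C → ℝ) (hr : ∀ i k, 0 ≤ r i k)
    (D D' : V → V → ℝ → ℝ) (B B' : V → ℝ → ℝ)
    (hD : LinkCostReg D D') (hB : CacheCostReg B B')
    (φ : V → V → C → ℝ) (y : V → C → ℝ) (t q δ : V → C → ℝ)
    (hfeas : Feasible E S φ y) (htraffic : TrafficEq r φ t)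
    (hq : MarginalEq E D' φ t q)
    (hδ : IsDelta E D' B' φ y t q δ)
    (hcache : CacheCond B' y t δ) (hroute : RouteCond E D' φ t q δ)
    (φ' : V → V → C → ℝ) (y' : V → C → ℝ) (t' : V → C → ℝ)
    (hfeas' : Feasible E S φ' y') (htraffic' : TrafficEq r φ' t') :
    totalCost E D B φ' y' t' - totalCost E D B φ y t ≥
      ∑ i, ∑ k, δ i k * (y i k - y' i k) * (t' i k - t i k) := by
  obtain ⟨hφ, hφE, hy, hsum⟩ := hfeas
  obtain ⟨hφ', hφE', hy', hsum'⟩ := hfeas'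
  set w : V → V → ℝ := fun a b => D' a b (linkFlow φ t a b) with hw
  have hlink : ∑ a, ∑ b, w a b * (linkFlow φ' t' a b - linkFlow φ t a b) ≤
      (∑ a, ∑ b, if E a b then D a b (linkFlow φ' t' a b) else 0) -
        ∑ a, ∑ b, if E a b then D a b (linkFlow φ t a b) else 0 := by
    simp only [← sum_sub_distrib]
    refine sum_le_sum fun a _ => sum_le_sum fun b _ => ?_
    by_cases h : E a b
    · simp only [h, if_true]
      exact (hD a b).2.2.1.hasDerivAt_mul_sub_le
        (linkFlow_nonneg (fun i j k => (hφ i j k).1) (fun i k => (htraffic i k).1) a b)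
        (linkFlow_nonneg (fun i j k => (hφ' i j k).1) (fun i k => (htraffic' i k).1) a b)
        ((hD a b).1 _)
    · have h' : ¬ E b a := fun hba => h (hEsymm _ _ hba)
      simp [h, linkFlow_eq_zero (hφE b a · h'), linkFlow_eq_zero (hφE' b a · h')]
  have hcacheCost : ∑ i, B' i (cacheSize y i) * (cacheSize y' i - cacheSize y i) ≤
      ∑ i, B i (cacheSize y' i) - ∑ i, B i (cacheSize y i) := by
    rw [← sum_sub_distrib]
    exact sum_le_sum fun i _ => (hB i).2.2.1.hasDerivAt_mul_sub_le
      (cacheSize_nonneg (fun i k => (hy i k).1) i) (cacheSize_nonneg (fun i k => (hy' i k).1) i)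
      ((hB i).1 _)
  have hcacheGap : ∑ i, ∑ k, t i k * δ i k * (y' i k - y i k) ≤
      ∑ i, B' i (cacheSize y i) * (cacheSize y' i - cacheSize y i) := by
    refine sum_le_sum fun i _ => ?_
    rw [cacheSize, cacheSize, ← sum_sub_distrib, mul_sum]
    refine sum_le_sum fun k _ => ?_
    rcases (hy i k).1.eq_or_lt with h | h
    · rw [← h, sub_zero]
      exact mul_le_mul_of_nonneg_right ((hcache i k).2 h.symm) (hy' i k).1
    · rw [← (hcache i k).1 h]; rfl
  have hδle : ∀ i j k, E i j → δ i k ≤ w j i + q j k := fun i j k h => by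
    rcases (hφ i j k).1.eq_or_lt with h0 | h0
    · exact (hroute i k j h).2 h0.symm
    · exact ((hroute i k j h).1 h0).ge
  have hqδ : ∀ i k, ∑ j, φ i j k * (w j i + q j k) = δ i k * ∑ j, φ i j k := fun i k => by
    rw [mul_sum]
    refine sum_congr rfl fun j _ => ?_
    rcases (hφ i j k).1.eq_or_lt with h0 | h0
    · simp [← h0]
    · have h : E i j := by
        by_contra h
        exact h0.ne' (hφE i j k h)
      rw [(hroute i k j h).1 h0, mul_comm]
  have hqeq : ∀ i k, q i k = ∑ j, φ i j k * (w j i + q j k) := fun i k => by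
    rw [hq i k]
    refine sum_congr rfl fun j _ => ?_
    by_cases h : E i j
    · simp [h, hw]
    · simp [h, hφE i j k h]
  have hroute' : ∀ i k, δ i k * ∑ j, φ' i j k ≤ ∑ j, φ' i j k * (w j i + q j k) := fun i k => by
    rw [mul_sum]
    refine sum_le_sum fun j _ => ?_
    by_cases h : E i j
    · rw [mul_comm]
      exact mul_le_mul_of_nonneg_left (hδle i j k h) (hφ' i j k).1
    · simp [hφE' i j k h]
  have hsplit : ∀ (ψ : V → V → C → ℝ) (s : V → C → ℝ), TrafficEq r ψ s → ∀ k,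
      ∑ i, ∑ j, w j i * (s i k * ψ i j k) =
        ∑ i, (s i k * ∑ j, ψ i j k * (w j i + q j k) - q i k * (s i k - r i k)) := by
    intro ψ s hs k
    rw [sum_sub_distrib, ← hs.sum_mul q k, ← sum_sub_distrib]
    refine sum_congr rfl fun i _ => ?_
    rw [mul_sum, ← sum_sub_distrib]
    exact sum_congr rfl fun j _ => by ring
  have hlinkGap : ∑ i, ∑ k, t' i k * δ i k * (y i k - y' i k) ≤
      ∑ a, ∑ b, w a b * (linkFlow φ' t' a b - linkFlow φ t a b) := by
    simp only [mul_sub, sum_sub_distrib (f := fun b => w _ b * _)]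
    simp only [sum_sub_distrib, sum_link_marginal, hsplit _ _ htraffic, hsplit _ _ htraffic']
    simp only [← sum_sub_distrib]
    rw [sum_comm]
    refine sum_le_sum fun k _ => sum_le_sum fun i _ => ?_
    have h1 := mul_le_mul_of_nonneg_left (hroute' i k) (htraffic' i k).1
    have h2 := hqeq i k
    have h3 := hqδ i k
    have h4 : ∑ j, φ' i j k = y i k + ∑ j, φ i j k - y' i k := by
      linarith [hsum i k, hsum' i k]
    rw [h4] at h1
    rw [← h2] at h3 ⊢
    rw [h3]
    linarith
  have hgap : ∑ i, ∑ k, δ i k * (y i k - y' i k) * (t' i k - t i k) =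
      ∑ i, ∑ k, t' i k * δ i k * (y i k - y' i k) +
        ∑ i, ∑ k, t i k * δ i k * (y' i k - y i k) := by
    simp only [← sum_add_distrib]
    exact sum_congr rfl fun i _ => sum_congr rfl fun k _ => by ring
  rw [hgap]
  unfold totalCost
  linarith
end
end

section
/- Let (φ,y) be any feasible strategy with traffic rates t satisfying the traffic equations and marginals q satisfying the marginal recursion. Then the following identity holds: Σ_{i∈V} Σ_{j∈N(i)} D'_ji(F_ji) · F_ji = Σ_{i∈V} Σ_{k∈C} q_i(k) · r_i(k). -/
open Finset

noncomputable section

variable {V C : Type*}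

/-- the identity
`∑_i ∑_{j∈N(i)} D'_ji(F_ji) F_ji = ∑_i ∑_k q_i(k) r_i(k)`. -/
theorem link_marginal_identity
    {V C : Type*} [Fintype V] [Fintype C] [DecidableEq V]
    (E : V → V → Prop) [DecidableRel E] (hEsymm : ∀ i j, E i j → E j i)
    (S : C → Finset V) (r : V → C → ℝ) (hr : ∀ i k, 0 ≤ r i k)
    (D D' : V → V → ℝ → ℝ)
    (hD : LinkCostReg D D')
    (φ : V → V → C → ℝ) (y : V → C → ℝ) (t q : V → C → ℝ)
    (hfeas : Feasible E S φ y) (htraffic : TrafficEq r φ t)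
    (hq : MarginalEq E D' φ t q) :
    (∑ i, ∑ j, if E i j then D' j i (linkFlow φ t j i) * linkFlow φ t j i else 0)
      = ∑ i, ∑ k, q i k * r i k := by
  have hφ : ∀ i j k, ¬ E i j → φ i j k = 0 := hfeas.2.1
  have hq_sum : ∀ i k, q i k = ∑ j, φ i j k * (D' j i (linkFlow φ t j i) + q j k) := by
    intro i k
    rw [hq i k]
    refine Finset.sum_congr rfl fun j _ => ?_
    split_ifs with h
    · rfl
    · rw [hφ i j k h, zero_mul]
  have hlink : ∀ i j, (if E i j then D' j i (linkFlow φ t j i) * linkFlow φ t j i else 0)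
      = ∑ k, t i k * φ i j k * D' j i (linkFlow φ t j i) := by
    intro i j
    rw [← Finset.sum_mul]
    change _ = linkFlow φ t j i * _
    split_ifs with h
    · rw [mul_comm]
    · have hF : linkFlow φ t j i = 0 :=
        Finset.sum_eq_zero fun k _ => by rw [hφ i j k h, mul_zero]
      rw [hF, zero_mul]
  have hitem : ∀ k, ∑ i, ∑ j, t i k * φ i j k * D' j i (linkFlow φ t j i)
      = ∑ i, q i k * r i k := by
    intro k
    have hout : ∑ i, t i k * q i k = ∑ i, ∑ j, t i k * φ i j k * D' j i (linkFlow φ t j i)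
        + ∑ i, ∑ j, t i k * φ i j k * q j k := by
      rw [← Finset.sum_add_distrib]
      refine Finset.sum_congr rfl fun i _ => ?_
      rw [hq_sum i k, Finset.mul_sum, ← Finset.sum_add_distrib]
      exact Finset.sum_congr rfl fun j _ => by ring
    have hin : ∑ i, t i k * q i k = ∑ i, q i k * r i k
        + ∑ i, ∑ j, t i k * φ i j k * q j k := by
      rw [Finset.sum_comm (f := fun i j => t i k * φ i j k * q j k), ← Finset.sum_add_distrib]
      refine Finset.sum_congr rfl fun i _ => ?_
      rw [← Finset.sum_mul, (htraffic i k).2, add_mul, mul_comm (r i k)]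
    exact add_right_cancel (hout.symm.trans hin)
  simp only [hlink]
  rw [Finset.sum_comm (f := fun i k => q i k * r i k)]
  simp only [← hitem]
  rw [Finset.sum_comm (s := univ (α := C))]
  exact Finset.sum_congr rfl fun i _ => Finset.sum_comm
end
end

section
/- Suppose (φ,y) is a feasible strategy with traffic rates t and marginals q, satisfying the routing part of the modified optimality condition: for all i∈V, k∈C and j∈N(i), D'_ji(F_ji)+q_j(k) = δ_i(k) whenever φ_ij(k)>0 and D'_ji(F_ji)+q_j(k) ≥ δ_i(k) whenever φ_ij(k)=0. Let (φ†,y†) be any feasible strategy with traffic rates t† and link flows F†. Then, with p_ik = Σ_{j∈N(i)} φ_ij(k) and p†_ik = Σ_{j∈N(i)} φ†_ij(k), it holds that Σ_{(j,i)∈E} D'_ji(F_ji)·(F†_ji − F_ji) ≥ Σ_{i∈V} Σ_{k∈C} δ_i(k)·(p†_ik − p_ik)·t†_i(k). -/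
open Finset

noncomputable section

variable {V C : Type*}

/-- Pairing a potential `q` with the traffic equations: the routed traffic collects
`∑ q (t - r)`. -/
lemma sum_mul_potential_of_traffic {V : Type*} [Fintype V] {φ : V → V → ℝ} {t r : V → ℝ}
    (q : V → ℝ) (h : ∀ i, t i = r i + ∑ j, t j * φ j i) :
    ∑ i, ∑ j, t i * φ i j * q j = ∑ j, q j * (t j - r j) := by
  rw [Finset.sum_comm]
  refine Finset.sum_congr rfl fun j _ => ?_
  rw [← Finset.sum_mul, eq_sub_of_add_eq' (h j).symm, mul_comm]

/-- The lower bound for one item, with link prices `c i j`. -/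
lemma single_item_link_cost_lower_bound {V : Type*} [Fintype V]
    {c φ φ' : V → V → ℝ} {t t' r q δ : V → ℝ}
    (ht : ∀ i, t i = r i + ∑ j, t j * φ j i)
    (ht' : ∀ i, t' i = r i + ∑ j, t' j * φ' j i)
    (hpos : ∀ i, 0 ≤ t' i)
    (hq : ∀ i, q i = ∑ j, φ i j * (c i j + q j))
    (hφ : ∀ i j, φ i j * (c i j + q j) = φ i j * δ i)
    (hφ' : ∀ i j, φ' i j * δ i ≤ φ' i j * (c i j + q j)) :
    ∑ i, δ i * ((∑ j, φ' i j) - ∑ j, φ i j) * t' i ≤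
      ∑ i, ∑ j, c i j * (t' i * φ' i j - t i * φ i j) := by
  have hqδ : ∀ i, q i = δ i * ∑ j, φ i j := fun i => by
    rw [hq i, Finset.mul_sum]
    exact Finset.sum_congr rfl fun j _ => by rw [hφ, mul_comm]
  have hold : ∑ i, ∑ j, t i * (φ i j * (c i j + q j)) = ∑ i, t i * q i :=
    Finset.sum_congr rfl fun i _ => by rw [← Finset.mul_sum, ← hq i]
  have hnew : ∑ i, t' i * (δ i * ∑ j, φ' i j) ≤
      ∑ i, ∑ j, t' i * (φ' i j * (c i j + q j)) := by
    refine Finset.sum_le_sum fun i _ => ?_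
    rw [← Finset.mul_sum, mul_comm (δ i), Finset.sum_mul]
    exact mul_le_mul_of_nonneg_left (Finset.sum_le_sum fun j _ => hφ' i j) (hpos i)
  have hsplit : ∑ i, ∑ j, c i j * (t' i * φ' i j - t i * φ i j) =
      (∑ i, ∑ j, t' i * (φ' i j * (c i j + q j)) - ∑ i, ∑ j, t' i * φ' i j * q j) -
      (∑ i, ∑ j, t i * (φ i j * (c i j + q j)) - ∑ i, ∑ j, t i * φ i j * q j) := by
    simp only [← Finset.sum_sub_distrib]
    exact Finset.sum_congr rfl fun i _ => Finset.sum_congr rfl fun j _ => by ring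
  have hgoal : ∑ i, δ i * ((∑ j, φ' i j) - ∑ j, φ i j) * t' i =
      ∑ i, t' i * (δ i * ∑ j, φ' i j) - ∑ i, t' i * q i := by
    rw [← Finset.sum_sub_distrib]
    exact Finset.sum_congr rfl fun i _ => by rw [hqδ i]; ring
  have hpot := sum_mul_potential_of_traffic q ht
  have hpot' := sum_mul_potential_of_traffic q ht'
  simp only [mul_sub, Finset.sum_sub_distrib, mul_comm (q _) (t _)] at hpot
  simp only [mul_sub, Finset.sum_sub_distrib, mul_comm (q _) (t' _)] at hpot'
  linarith

/-- under the routing part of the modified condition, for any feasible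
`(φ†,y†)` with traffic `t†` and flows `F†`,
`∑_{(j,i)∈E} D'_ji(F_ji)(F†_ji − F_ji) ≥ ∑_i ∑_k δ_i(k)(p†_ik − p_ik) t†_i(k)`. -/
theorem link_cost_lower_bound
    {V C : Type*} [Fintype V] [Fintype C] [DecidableEq V]
    (E : V → V → Prop) [DecidableRel E] (hEsymm : ∀ i j, E i j → E j i)
    (hN : ∀ i, ∃ j, E i j)
    (S : C → Finset V) (r : V → C → ℝ) (hr : ∀ i k, 0 ≤ r i k)
    (D D' : V → V → ℝ → ℝ) (B B' : V → ℝ → ℝ)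
    (hD : LinkCostReg D D') (hB : CacheCostReg B B')
    (φ : V → V → C → ℝ) (y : V → C → ℝ) (t q δ : V → C → ℝ)
    (hfeas : Feasible E S φ y) (htraffic : TrafficEq r φ t)
    (hq : MarginalEq E D' φ t q)
    (hδ : IsDelta E D' B' φ y t q δ)
    (hroute : RouteCond E D' φ t q δ)
    (φ' : V → V → C → ℝ) (y' : V → C → ℝ) (t' : V → C → ℝ)
    (hfeas' : Feasible E S φ' y') (htraffic' : TrafficEq r φ' t') :
    (∑ a, ∑ b, if E a b then
        D' a b (linkFlow φ t a b) * (linkFlow φ' t' a b - linkFlow φ t a b) else 0)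
      ≥ ∑ i, ∑ k, δ i k *
          ((∑ j, if E i j then φ' i j k else 0) - (∑ j, if E i j then φ i j k else 0))
          * t' i k := by
  have hdrop : ∀ ψ : V → V → C → ℝ, (∀ i j k, ¬ E i j → ψ i j k = 0) → ∀ i k,
      (∑ j, if E i j then ψ i j k else 0) = ∑ j, ψ i j k := fun ψ hψ i k =>
    Finset.sum_congr rfl fun j _ => by
      split_ifs with h
      · rfl
      · exact (hψ i j k h).symm
  obtain ⟨hφ01, hφE, -, -⟩ := hfeas
  obtain ⟨hφ01', hφE', -, -⟩ := hfeas'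
  have hlhs : (∑ a, ∑ b, if E a b then
        D' a b (linkFlow φ t a b) * (linkFlow φ' t' a b - linkFlow φ t a b) else 0) =
      ∑ k, ∑ i, ∑ j, D' j i (linkFlow φ t j i) *
        (t' i k * φ' i j k - t i k * φ i j k) := by
    rw [Finset.sum_comm, Finset.sum_comm (s := (univ : Finset C))]
    refine Finset.sum_congr rfl fun i _ => ?_
    rw [Finset.sum_comm (s := (univ : Finset C))]
    refine Finset.sum_congr rfl fun j _ => ?_
    rw [← Finset.mul_sum, Finset.sum_sub_distrib]
    split_ifs with h
    · rfl
    · have hij : ¬ E i j := fun h' => h (hEsymm i j h')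
      simp [hφE _ _ _ hij, hφE' _ _ _ hij]
  rw [ge_iff_le, hlhs, Finset.sum_comm]
  refine Finset.sum_le_sum fun k _ => ?_
  simp only [hdrop φ hφE, hdrop φ' hφE']
  refine single_item_link_cost_lower_bound (c := fun i j => D' j i (linkFlow φ t j i))
    (r := fun i => r i k) (q := fun i => q i k)
    (fun i => (htraffic i k).2) (fun i => (htraffic' i k).2) (fun i => (htraffic' i k).1)
    (fun i => ?_) (fun i j => ?_) (fun i j => ?_)
  · rw [hq i k]
    refine Finset.sum_congr rfl fun j _ => ?_
    split_ifs with h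
    · rfl
    · simp [hφE i j k h]
  · rcases (hφ01 i j k).1.eq_or_lt with h | h
    · simp [← h]
    · have hE : E i j := by
        by_contra hE
        exact h.ne' (hφE i j k hE)
      exact congrArg (φ i j k * ·) ((hroute i k j hE).1 h)
  · by_cases hE : E i j
    · refine mul_le_mul_of_nonneg_left ?_ (hφ01' i j k).1
      rcases (hφ01 i j k).1.eq_or_lt with h | h
      · exact (hroute i k j hE).2 h.symm
      · exact ((hroute i k j hE).1 h).ge
    · simp [hφE' i j k hE]
end
end

section
/- Suppose (φ,y) is a feasible strategy with traffic rates t and marginals q, satisfying the caching part of the modified optimality condition: for all i∈V and k∈C, B'_i(Y_i) = t_i(k)δ_i(k) whenever y_i(k)>0 and B'_i(Y_i) ≥ t_i(k)δ_i(k) whenever y_i(k)=0. Let (φ†,y†) be any feasible strategy, and set p_ik = Σ_{j∈N(i)} φ_ij(k) and p†_ik = Σ_{j∈N(i)} φ†_ij(k). Then Σ_{i∈V} B'_i(Y_i)·(Y†_i − Y_i) ≥ Σ_{i∈V} Σ_{k∈C} t_i(k)·δ_i(k)·(p_ik − p†_ik). -/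
open Finset

noncomputable section

variable {V C : Type*}

/-- under the caching part of the modified condition, for any feasible
`(φ†,y†)`, `∑_i B'_i(Y_i)(Y†_i − Y_i) ≥ ∑_i ∑_k t_i(k) δ_i(k) (p_ik − p†_ik)`. -/
theorem cache_cost_lower_bound
    {V C : Type*} [Fintype V] [Fintype C] [DecidableEq V]
    (E : V → V → Prop) [DecidableRel E] (hEsymm : ∀ i j, E i j → E j i)
    (hN : ∀ i, ∃ j, E i j)
    (S : C → Finset V) (r : V → C → ℝ) (hr : ∀ i k, 0 ≤ r i k)
    (D D' : V → V → ℝ → ℝ) (B B' : V → ℝ → ℝ)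
    (hD : LinkCostReg D D') (hB : CacheCostReg B B')
    (φ : V → V → C → ℝ) (y : V → C → ℝ) (t q δ : V → C → ℝ)
    (hfeas : Feasible E S φ y) (htraffic : TrafficEq r φ t)
    (hq : MarginalEq E D' φ t q)
    (hδ : IsDelta E D' B' φ y t q δ)
    (hcache : CacheCond B' y t δ)
    (φ' : V → V → C → ℝ) (y' : V → C → ℝ)
    (hfeas' : Feasible E S φ' y') :
    (∑ i, B' i (cacheSize y i) * (cacheSize y' i - cacheSize y i))
      ≥ ∑ i, ∑ k, t i k * δ i k *
          ((∑ j, if E i j then φ i j k else 0) - (∑ j, if E i j then φ' i j k else 0)) := by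
  have sum_edges : ∀ (ψ : V → V → C → ℝ) (z : V → C → ℝ), Feasible E S ψ z → ∀ i k,
      (∑ j, if E i j then ψ i j k else 0) = (if i ∈ S k then 0 else 1) - z i k := by
    intro ψ z hψ i k
    rw [← hψ.2.2.2 i k, add_sub_cancel_left]
    refine Finset.sum_congr rfl fun j _ => ?_
    split_ifs with h
    · rfl
    · exact (hψ.2.1 i j k h).symm
  refine Finset.sum_le_sum fun i _ => ?_
  have hsize : cacheSize y' i - cacheSize y i = ∑ k, (y' i k - y i k) :=
    (Finset.sum_sub_distrib _ _).symm
  rw [hsize, Finset.mul_sum]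
  refine Finset.sum_le_sum fun k _ => ?_
  rw [sum_edges φ y hfeas, sum_edges φ' y' hfeas', sub_sub_sub_cancel_left]
  rcases (hfeas.2.2.1 i k).1.eq_or_lt with h | h
  · refine mul_le_mul_of_nonneg_right ((hcache i k).2 h.symm) ?_
    rw [← h, sub_zero]
    exact (hfeas'.2.2.1 i k).1
  · rw [(hcache i k).1 h]
end
end

section
/- Let (φ*,y*) be a feasible strategy that globally minimizes the total cost T, with finite optimal cost and with loop-free routing (for each item k, the digraph on V with edges (i,j) such that φ*_ij(k)>0 is acyclic), and let t* be its traffic rates. Then there exists a feasible strategy (φ,y) satisfying the modified optimality condition such that y = y*, φ_ij(k) = φ*_ij(k) for all nodes i, items k with t*_i(k) > 0 and all j, and T(φ,y) = T(φ*,y*). -/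
open Finset

noncomputable section

variable {V C : Type*}

open Filter Topology

/-- A function that does not drop below its value at `x` immediately to the right of `x` has
nonnegative derivative there. -/
lemma HasDerivAt.nonneg_of_eventually_le_right {h : ℝ → ℝ} {h' x : ℝ} (hd : HasDerivAt h h' x)
    (hle : ∀ᶠ s in 𝓝[>] x, h x ≤ h s) : 0 ≤ h' := by
  have ht := hasDerivWithinAt_iff_tendsto_slope.1 (hd.hasDerivWithinAt (s := Set.Ioi x))
  rw [Set.sdiff_singleton_eq_self (by simp)] at ht
  refine ge_of_tendsto ht ?_
  filter_upwards [hle, self_mem_nhdsWithin] with s hs hxs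
  rw [slope_def_field]
  exact div_nonneg (sub_nonneg.2 hs) (sub_nonneg.2 (le_of_lt hxs))

lemma deriv_nonneg_of_monotoneOn_Ici {h : ℝ → ℝ} {h' x : ℝ} (hd : HasDerivAt h h' x)
    (hm : MonotoneOn h (Set.Ici 0)) (hx : 0 ≤ x) : 0 ≤ h' := by
  refine hd.nonneg_of_eventually_le_right ?_
  filter_upwards [self_mem_nhdsWithin] with s hs
  have hs' : x ≤ s := le_of_lt hs
  exact hm hx (hx.trans hs') hs'

/-- A nonzero entry of a power of a nonnegative matrix comes from a walk in its support. -/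
lemma exists_walk_of_matrix_pow_ne_zero [Fintype V] [DecidableEq V] {P : Matrix V V ℝ}
    (hP : ∀ i j, 0 ≤ P i j) (n : ℕ) : ∀ i j, (P ^ n) i j ≠ 0 →
      ∃ c : ℕ → V, c n = j ∧ ∀ l < n, 0 < P (c l) (c (l + 1)) := by
  induction n with
  | zero => exact fun i j _ => ⟨fun _ => j, rfl, by simp⟩
  | succ n ih =>
    intro i j hij
    rw [pow_succ, Matrix.mul_apply] at hij
    obtain ⟨m, -, hm⟩ := Finset.exists_ne_zero_of_sum_ne_zero hij
    obtain ⟨c, hc, hl⟩ := ih i m (left_ne_zero_of_mul hm)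
    refine ⟨fun l => if l ≤ n then c l else j, by simp, fun l hln => ?_⟩
    rcases Nat.lt_succ_iff_lt_or_eq.1 hln with h | rfl
    · simpa [h.le, Nat.succ_le_of_lt h] using hl l h
    · simpa [hc] using (hP m j).lt_of_ne' (right_ne_zero_of_mul hm)

lemma matrix_pow_card_eq_zero [Fintype V] [DecidableEq V] {P : Matrix V V ℝ}
    (hP : ∀ i j, 0 ≤ P i j)
    (hacyclic : ¬ ∃ (n : ℕ) (c : ℕ → V), 0 < n ∧ c 0 = c n ∧ ∀ l < n, 0 < P (c l) (c (l + 1))) :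
    P ^ Fintype.card V = 0 := by
  by_contra hne
  obtain ⟨i, j, hij⟩ : ∃ i j, (P ^ Fintype.card V) i j ≠ 0 := by
    by_contra! h
    exact hne (Matrix.ext h)
  obtain ⟨c, -, hl⟩ := exists_walk_of_matrix_pow_ne_zero hP _ i j hij
  obtain ⟨a, b, hab, hcab⟩ := Fintype.exists_ne_map_eq_of_card_lt
    (fun l : Fin (Fintype.card V + 1) => c l) (by simp)
  wlog hlt : a < b generalizing a b
  · exact this b a hab.symm hcab.symm (lt_of_le_of_ne (not_lt.1 hlt) hab.symm)
  refine hacyclic ⟨b - a, fun l => c (a + l), Nat.sub_pos_of_lt hlt, ?_, fun l hlb => ?_⟩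
  · simpa [Nat.add_sub_cancel' (Fin.le_def.1 hlt.le)] using hcab
  · exact hl (a + l) (by omega)

/-- For acyclic routing `P` there is a matrix `N = (1 - P)⁻¹` of expected visit counts; it is
nonnegative, and it is controlled by any traffic vector `t ≥ t P`. -/
lemma exists_visit_matrix [Fintype V] [DecidableEq V] {P : Matrix V V ℝ}
    (hP : ∀ i j, 0 ≤ P i j)
    (hacyclic : ¬ ∃ (n : ℕ) (c : ℕ → V), 0 < n ∧ c 0 = c n ∧ ∀ l < n, 0 < P (c l) (c (l + 1)))
    {t : V → ℝ} (ht : ∀ i, 0 ≤ t i) (htP : ∀ i, ∑ j, t j * P j i ≤ t i) :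
    ∃ N : V → V → ℝ, (∀ i j, 0 ≤ N i j) ∧
      (∀ j i, N j i = (if i = j then 1 else 0) + ∑ l, N j l * P l i) ∧
      (∀ j i, N j i = (if i = j then 1 else 0) + ∑ l, P j l * N l i) ∧
      ∀ j i, t j * N j i ≤ Fintype.card V * t i := by
  have hzero := matrix_pow_card_eq_zero hP hacyclic
  have hpow : ∀ n i j, 0 ≤ (P ^ n) i j := by
    intro n
    induction n with
    | zero => intro i j; rw [pow_zero, Matrix.one_apply]; split_ifs <;> norm_num
    | succ n ih =>
      intro i j
      rw [pow_succ, Matrix.mul_apply]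
      exact Finset.sum_nonneg fun m _ => mul_nonneg (ih i m) (hP m j)
  have htpow : ∀ n i, ∑ j, t j * (P ^ n) j i ≤ t i := by
    intro n
    induction n with
    | zero => intro i; simp [Matrix.one_apply]
    | succ n ih =>
      intro i
      calc ∑ j, t j * (P ^ (n + 1)) j i = ∑ m, (∑ j, t j * (P ^ n) j m) * P m i := by
            simp only [pow_succ, Matrix.mul_apply, Finset.mul_sum, Finset.sum_mul]
            rw [Finset.sum_comm]
            simp only [mul_assoc]
        _ ≤ ∑ m, t m * P m i :=
            Finset.sum_le_sum fun m _ => mul_le_mul_of_nonneg_right (ih m) (hP m i)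
        _ ≤ t i := htP i
  set M : Matrix V V ℝ := ∑ n ∈ Finset.range (Fintype.card V), P ^ n with hM
  have hleft : M = 1 + M * P := by
    have h1 := Finset.sum_range_succ (fun n => P ^ n) (Fintype.card V)
    rw [Finset.sum_range_succ', hzero, add_zero, pow_zero] at h1
    rw [hM, Finset.sum_mul, ← h1, add_comm]
    simp only [pow_succ]
  have hright : M = 1 + P * M := by
    have h1 := Finset.sum_range_succ (fun n => P ^ n) (Fintype.card V)
    rw [Finset.sum_range_succ', hzero, add_zero, pow_zero] at h1
    rw [hM, Finset.mul_sum, ← h1, add_comm]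
    simp only [pow_succ']
  refine ⟨M, fun i j => ?_, fun j i => ?_, fun j i => ?_, fun j i => ?_⟩
  · rw [hM, Matrix.sum_apply]
    exact Finset.sum_nonneg fun n _ => hpow n i j
  · conv_lhs => rw [hleft]
    simp [Matrix.add_apply, Matrix.one_apply, Matrix.mul_apply, eq_comm]
  · conv_lhs => rw [hright]
    simp [Matrix.add_apply, Matrix.one_apply, Matrix.mul_apply, eq_comm]
  · rw [hM, Matrix.sum_apply, Finset.mul_sum]
    calc ∑ n ∈ Finset.range (Fintype.card V), t j * (P ^ n) j i
        ≤ ∑ n ∈ Finset.range (Fintype.card V), t i := by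
          refine Finset.sum_le_sum fun n _ => le_trans ?_ (htpow n i)
          exact Finset.single_le_sum (f := fun j => t j * (P ^ n) j i)
            (fun j _ => mul_nonneg (ht j) (hpow n j i)) (Finset.mem_univ j)
      _ = Fintype.card V * t i := by simp

/-- Nonnegative flow on the links of `E` created by one unit of traffic entering at `j`, when node
`i` forwards the fraction `ρ i` of its traffic. -/
structure IsUnitFlow [Fintype V] [DecidableEq V] (E : V → V → Prop) (ρ : V → ℝ) (j : V)
    (x : V → V → ℝ) : Prop where
  nonneg : ∀ a b, 0 ≤ x a b
  supp : ∀ a b, ¬ E a b → x a b = 0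
  conserve : ∀ i, ∑ b, x i b = ρ i * ((if i = j then 1 else 0) + ∑ l, x l i)

/-- The flow `x` together with one unit of flow on the link `(i, j)`. -/
def prependLink [DecidableEq V] (i j : V) (x : V → V → ℝ) (a b : V) : ℝ :=
  (if a = i ∧ b = j then 1 else 0) + x a b

lemma IsUnitFlow.prependLink_nonneg [Fintype V] [DecidableEq V] {E : V → V → Prop} {ρ : V → ℝ}
    {i j : V} {x : V → V → ℝ} (hx : IsUnitFlow E ρ j x) (a b : V) : 0 ≤ prependLink i j x a b :=
  add_nonneg (by split_ifs <;> norm_num) (hx.nonneg a b)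

lemma IsUnitFlow.prependLink_supp [Fintype V] [DecidableEq V] {E : V → V → Prop} {ρ : V → ℝ}
    {i j : V} {x : V → V → ℝ} (hx : IsUnitFlow E ρ j x) (hE : E i j) {a b : V} (hab : ¬ E a b) :
    prependLink i j x a b = 0 := by
  have : ¬ (a = i ∧ b = j) := by rintro ⟨rfl, rfl⟩; exact hab hE
  simp [prependLink, this, hx.supp a b hab]

lemma IsUnitFlow.sum_prependLink [Fintype V] [DecidableEq V] {E : V → V → Prop} {ρ : V → ℝ}
    {i j : V} {x : V → V → ℝ} (hx : IsUnitFlow E ρ j x) (a : V) :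
    ∑ b, prependLink i j x a b = (if a = i then 1 else 0) + ρ a * ∑ l, prependLink i j x l a := by
  have h1 : ∑ l, (if l = i ∧ a = j then (1 : ℝ) else 0) = if a = j then 1 else 0 := by
    simp [ite_and]
  have h2 : ∑ b, (if a = i ∧ b = j then (1 : ℝ) else 0) = if a = i then 1 else 0 := by
    by_cases h : a = i <;> simp [h]
  simp only [prependLink, Finset.sum_add_distrib, h1, h2, hx.conserve a]

lemma sum_prependLink_mul [Fintype V] [DecidableEq V] (i j : V) (x c : V → V → ℝ) :
    ∑ a, ∑ b, prependLink i j x a b * c a b = c i j + ∑ a, ∑ b, x a b * c a b := by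
  have h1 : ∀ a, ∑ b, (if a = i ∧ b = j then (1 : ℝ) else 0) * c a b
      = if a = i then c a j else 0 := by
    intro a; by_cases h : a = i <;> simp [h]
  simp only [prependLink, add_mul, Finset.sum_add_distrib, h1]
  simp

/-- Costs of the policies that use a deterministic next hop for finitely many steps and then
continue with a default policy, whose costs are `q₀`. -/
inductive PolicyCost (E : V → V → Prop) (c : V → V → ℝ) (ρ : V → ℝ) (q₀ : V → ℝ) : V → ℝ → Prop
  | base (j : V) : PolicyCost E c ρ q₀ j (q₀ j)
  | step (i j : V) (v : ℝ) : E i j → PolicyCost E c ρ q₀ j v →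
      PolicyCost E c ρ q₀ i (ρ i * (c i j + v))

lemma PolicyCost.nonneg {E : V → V → Prop} {c : V → V → ℝ} {ρ q₀ : V → ℝ}
    (hc : ∀ i j, 0 ≤ c i j) (hρ : ∀ i, 0 ≤ ρ i) (hq₀ : ∀ i, 0 ≤ q₀ i) {i : V} {v : ℝ}
    (h : PolicyCost E c ρ q₀ i v) : 0 ≤ v := by
  induction h with
  | base j => exact hq₀ j
  | step i j v _ _ ih => exact mul_nonneg (hρ i) (add_nonneg (hc i j) ih)

lemma PolicyCost.exists_unitFlow [Fintype V] [DecidableEq V] {E : V → V → Prop}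
    {c : V → V → ℝ} {ρ q₀ : V → ℝ} (hρ : ∀ i, 0 ≤ ρ i)
    (hbase : ∀ j, ∃ x, IsUnitFlow E ρ j x ∧ ∑ a, ∑ b, x a b * c a b = q₀ j) {i : V} {v : ℝ}
    (h : PolicyCost E c ρ q₀ i v) :
    ∃ x, IsUnitFlow E ρ i x ∧ ∑ a, ∑ b, x a b * c a b = v := by
  induction h with
  | base j => exact hbase j
  | step i j v hE _ ih =>
    obtain ⟨x, hx, hxv⟩ := ih
    refine ⟨fun a b => ρ i * prependLink i j x a b,
      ⟨fun a b => mul_nonneg (hρ i) (hx.prependLink_nonneg a b),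
        fun a b hab => by rw [hx.prependLink_supp hE hab, mul_zero], fun a => ?_⟩, ?_⟩
    · rw [← Finset.mul_sum, ← Finset.mul_sum, hx.sum_prependLink]
      by_cases h : a = i
      · subst h; simp
      · simp only [h, if_false]; ring
    · simp only [mul_assoc, ← Finset.mul_sum]
      rw [sum_prependLink_mul, hxv]

/-- The infimal policy costs solve the Bellman equation. -/
lemma exists_bellman_solution [Fintype V] {E : V → V → Prop}
    (hN : ∀ i, ∃ j, E i j) {c : V → V → ℝ} {P : V → V → ℝ} {q₀ : V → ℝ}
    (hc : ∀ i j, 0 ≤ c i j) (hP : ∀ i j, 0 ≤ P i j) (hPE : ∀ i j, ¬ E i j → P i j = 0)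
    (hq₀ : ∀ i, 0 ≤ q₀ i) (hrec : ∀ i, q₀ i = ∑ j, P i j * (c i j + q₀ j)) :
    ∃ (q : V → ℝ) (next : V → V),
      (∀ i, E i (next i)) ∧
      (∀ i j, E i j → c i (next i) + q (next i) ≤ c i j + q j) ∧
      (∀ i, q i = (∑ j, P i j) * (c i (next i) + q (next i))) ∧
      (∀ i, q i ≤ q₀ i) ∧
      ∀ i b, (∀ v, PolicyCost E c (fun i => ∑ j, P i j) q₀ i v → b ≤ v) → b ≤ q i := by
  have hρ : ∀ i, 0 ≤ ∑ j, P i j := fun i => Finset.sum_nonneg fun j _ => hP i j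
  set R := PolicyCost E c (fun i => ∑ j, P i j) q₀
  set q : V → ℝ := fun i => sInf {v | R i v}
  have hbdd : ∀ i, BddBelow {v | R i v} := fun i => ⟨0, fun v hv => hv.nonneg hc hρ hq₀⟩
  have hne : ∀ i, {v | R i v}.Nonempty := fun i => ⟨_, PolicyCost.base i⟩
  have hle : ∀ i v, R i v → q i ≤ v := fun i v hv => csInf_le (hbdd i) hv
  have hge : ∀ i b, (∀ v, R i v → b ≤ v) → b ≤ q i := fun i b hb => le_csInf (hne i) hb
  have hmin : ∀ i, ∃ j, E i j ∧ ∀ j', E i j' → c i j + q j ≤ c i j' + q j' := by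
    intro i
    obtain ⟨j, hj, hj'⟩ := Set.exists_min_image {j | E i j} (fun j => c i j + q j)
      (Set.toFinite _) (hN i)
    exact ⟨j, hj, hj'⟩
  choose next hnE hnmin using hmin
  refine ⟨q, next, hnE, hnmin, fun i => le_antisymm ?_ (hge i _ fun v hv => ?_),
    fun i => hle i _ (PolicyCost.base i), hge⟩
  · rcases (hρ i).eq_or_lt with h0 | hpos
    · have := hle i _ (PolicyCost.step i (next i) _ (hnE i) (PolicyCost.base _))
      simpa [← h0] using this
    · rw [← div_le_iff₀' hpos, ← sub_le_iff_le_add']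
      refine hge _ _ fun v hv => ?_
      rw [sub_le_iff_le_add', div_le_iff₀' hpos]
      exact hle i _ (PolicyCost.step i (next i) v (hnE i) hv)
  · cases hv with
    | base =>
      rw [hrec i, Finset.sum_mul]
      refine Finset.sum_le_sum fun j _ => ?_
      by_cases hE : E i j
      · refine mul_le_mul_of_nonneg_left ((hnmin i j hE).trans ?_) (hP i j)
        linarith [hle j _ (PolicyCost.base j)]
      · simp [hPE i j hE]
    | step _ j w hE hw =>
      refine mul_le_mul_of_nonneg_left ((hnmin i j hE).trans ?_) (hρ i)
      linarith [hle j w hw]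

/-- Link flows obeying flow conservation come from a feasible strategy. -/
lemma exists_strategy_of_flow [Fintype V] [DecidableEq V] {E : V → V → Prop}
    (hN : ∀ i, ∃ j, E i j) {S : C → Finset V} {r : V → C → ℝ} (hr : ∀ i k, 0 ≤ r i k)
    {y : V → C → ℝ} (hy0 : ∀ i k, 0 ≤ y i k)
    (hy1 : ∀ i k, y i k ≤ if i ∈ S k then 0 else 1)
    {f : V → V → C → ℝ} (hf : ∀ i j k, 0 ≤ f i j k) (hfE : ∀ i j k, ¬ E i j → f i j k = 0)
    {t : V → C → ℝ} (ht : ∀ i k, t i k = r i k + ∑ j, f j i k)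
    (hcons : ∀ i k, ∑ j, f i j k = ((if i ∈ S k then 0 else 1) - y i k) * t i k) :
    ∃ φ : V → V → C → ℝ, Feasible E S φ y ∧ TrafficEq r φ t ∧ ∀ i j k, t i k * φ i j k = f i j k := by
  choose n hn using hN
  have ht0 : ∀ i k, 0 ≤ t i k := fun i k => by
    rw [ht]; exact add_nonneg (hr i k) (Finset.sum_nonneg fun j _ => hf j i k)
  set ρ : V → C → ℝ := fun i k => (if i ∈ S k then 0 else 1) - y i k with hρdef
  have hρ0 : ∀ i k, 0 ≤ ρ i k := fun i k => sub_nonneg.2 (hy1 i k)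
  have hle1 : ∀ i k, (if i ∈ S k then (0 : ℝ) else 1) ≤ 1 := fun i k => by split_ifs <;> norm_num
  have hρ1 : ∀ i k, ρ i k ≤ 1 := fun i k => by
    have := hle1 i k
    have := hy0 i k
    simp only [hρdef]; linarith
  set φ : V → V → C → ℝ := fun i j k =>
    if t i k = 0 then (if j = n i then ρ i k else 0) else f i j k / t i k with hφ
  have hφ0 : ∀ i j k, 0 ≤ φ i j k := fun i j k => by
    simp only [hφ]
    split_ifs
    exacts [hρ0 i k, le_rfl, div_nonneg (hf i j k) (ht0 i k)]
  have hsum : ∀ i k, ∑ j, φ i j k = ρ i k := fun i k => by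
    simp only [hφ]
    by_cases h : t i k = 0
    · simp [h]
    · simp only [h, if_false, ← Finset.sum_div, hcons]
      rw [mul_div_assoc, div_self h, mul_one]
  have hmul : ∀ i j k, t i k * φ i j k = f i j k := fun i j k => by
    by_cases h : t i k = 0
    · have hz := hcons i k
      rw [h, mul_zero, Finset.sum_eq_zero_iff_of_nonneg fun j _ => hf i j k] at hz
      simp [h, hz j (Finset.mem_univ j)]
    · simp only [hφ, h, if_false]
      field_simp
  refine ⟨φ, ⟨fun i j k => ⟨hφ0 i j k, ?_⟩, fun i j k hE => ?_, fun i k => ⟨hy0 i k, ?_⟩,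
    fun i k => ?_⟩, fun i k => ⟨ht0 i k, ?_⟩, hmul⟩
  · refine le_trans ?_ ((hsum i k).le.trans (hρ1 i k))
    exact Finset.single_le_sum (f := fun j => φ i j k) (fun j _ => hφ0 i j k) (Finset.mem_univ j)
  · have : j ≠ n i := by rintro rfl; exact hE (hn i)
    simp [hφ, this, hfE i j k hE]
  · exact (hy1 i k).trans (hle1 i k)
  · rw [hsum]; simp [hρdef]
  · simp only [hmul]; exact ht i k

/-- First-order optimality along a perturbation that changes the flow of item `k` by `s • g` and
the caching variable of `k` at `i₀` by `-η s`. -/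
lemma first_order_condition [Fintype V] [Fintype C] [DecidableEq V]
    {E : V → V → Prop} [DecidableRel E] (hEsymm : ∀ i j, E i j → E j i)
    (hN : ∀ i, ∃ j, E i j)
    {S : C → Finset V} {r : V → C → ℝ} (hr : ∀ i k, 0 ≤ r i k)
    {D D' : V → V → ℝ → ℝ} {B B' : V → ℝ → ℝ}
    (hD : LinkCostReg D D') (hB : CacheCostReg B B')
    {φs : V → V → C → ℝ} {ys : V → C → ℝ} {ts : V → C → ℝ}
    (hfeas : Feasible E S φs ys) (htraffic : TrafficEq r φs ts)
    (hopt : ∀ (φ' : V → V → C → ℝ) (y' : V → C → ℝ) (t' : V → C → ℝ),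
      Feasible E S φ' y' → TrafficEq r φ' t' →
      totalCost E D B φs ys ts ≤ totalCost E D B φ' y' t')
    (k : C) (i₀ : V) {g : V → V → ℝ} {η : ℝ → ℝ} {d : ℝ}
    (hgE : ∀ a b, ¬ E a b → g a b = 0)
    {K : ℝ} (hK : ∀ a b, -(K * (ts a k * φs a b k)) ≤ g a b)
    (hη : HasDerivAt η d 0) (hη0 : η 0 = 0)
    (hy : ∀ᶠ s in 𝓝[>] (0 : ℝ), η s ≤ ys i₀ k)
    (hρ : ∀ᶠ s in 𝓝[>] (0 : ℝ), 0 ≤ ∑ j, φs i₀ j k + η s)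
    (hcons : ∀ᶠ s in 𝓝[>] (0 : ℝ), ∀ i, s * ∑ b, g i b = s * ((∑ j, φs i j k) * ∑ l, g l i) +
      if i = i₀ then η s * (ts i₀ k + s * ∑ l, g l i₀) else 0) :
    d * B' i₀ (cacheSize ys i₀) ≤ ∑ a, ∑ b, g a b * D' b a (linkFlow φs ts b a) := by
  classical
  obtain ⟨hφ, hφE, hys, hbal⟩ := hfeas
  set F : ℝ → ℝ := fun s =>
    (∑ a, ∑ b, if E a b then D a b (linkFlow φs ts a b + s * g b a) else 0) +
      ∑ i, B i (cacheSize ys i - if i = i₀ then η s else 0) with hF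
  have hF0 : F 0 = totalCost E D B φs ys ts := by simp [hF, totalCost, hη0]
  have hFd : HasDerivAt F
      ((∑ a, ∑ b, if E a b then D' a b (linkFlow φs ts a b) * g b a else 0) +
        ∑ i, B' i (cacheSize ys i) * (-(if i = i₀ then d else 0))) 0 := by
    refine HasDerivAt.add (HasDerivAt.fun_sum fun a _ => HasDerivAt.fun_sum fun b _ => ?_)
      (HasDerivAt.fun_sum fun i _ => ?_)
    · split_ifs with hE
      · have hlin : HasDerivAt (fun s : ℝ => linkFlow φs ts a b + s * g b a) (g b a) 0 := by
          simpa using ((hasDerivAt_id (0 : ℝ)).mul_const (g b a)).const_add (linkFlow φs ts a b)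
        have hout := (hD a b).1 (linkFlow φs ts a b)
        exact HasDerivAt.comp_of_eq (0 : ℝ) hout hlin (by simp)
      · exact hasDerivAt_const _ _
    · have hlin : HasDerivAt (fun s : ℝ => cacheSize ys i - if i = i₀ then η s else 0)
          (-(if i = i₀ then d else 0)) 0 := by
        refine HasDerivAt.const_sub _ ?_
        split_ifs
        exacts [hη, hasDerivAt_const _ _]
      exact HasDerivAt.comp_of_eq (0 : ℝ) ((hB i).1 (cacheSize ys i)) hlin (by simp [hη0])
  have hnonneg := hFd.nonneg_of_eventually_le_right (by
    have hsmall : ∀ᶠ s in 𝓝[>] (0 : ℝ), s * K ≤ 1 := by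
      have : Tendsto (fun s : ℝ => s * K) (𝓝[>] 0) (𝓝 0) :=
        ((continuous_mul_const K).tendsto' 0 0 (zero_mul K)).mono_left nhdsWithin_le_nhds
      exact this.eventually_le_const (by norm_num)
    filter_upwards [hy, hρ, hcons, hsmall, self_mem_nhdsWithin] with s hys' hρs hcs hsK hs
    have hs0 : 0 < s := hs
    set f : V → V → C → ℝ := fun a b k' => ts a k' * φs a b k' + if k' = k then s * g a b else 0
      with hf
    set y : V → C → ℝ := fun i k' => ys i k' - if k' = k then (if i = i₀ then η s else 0) else 0
      with hydef
    set t : V → C → ℝ := fun i k' => ts i k' + if k' = k then s * ∑ l, g l i else 0 with htdef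
    have hbal' : ∀ i k, (if i ∈ S k then (0 : ℝ) else 1) - ys i k = ∑ j, φs i j k := fun i k => by
      rw [← hbal i k]; ring
    have hex := exists_strategy_of_flow (E := E) (S := S) hN hr (y := y)
      (f := f) (t := t) ?_ ?_ ?_ ?_ ?_ ?_
    · obtain ⟨φ', hfe, htr, hmul⟩ := hex
      rw [hF0]
      refine (hopt φ' y t hfe htr).trans (le_of_eq ?_)
      have hlf : ∀ a b, linkFlow φ' t a b = linkFlow φs ts a b + s * g b a := fun a b => by
        simp [linkFlow, hmul, hf, Finset.sum_add_distrib]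
      have hcs : ∀ i, cacheSize y i = cacheSize ys i - if i = i₀ then η s else 0 := fun i => by
        simp [cacheSize, hydef, Finset.sum_sub_distrib]
      simp only [totalCost, hlf, hcs, hF]
    · intro i k'
      simp only [hydef]
      split_ifs with h1 h2
      · subst h1 h2; linarith
      · simpa using (hys i k').1
      · simpa using (hys i k').1
    · intro i k'
      rw [← sub_nonneg]
      have h0 : 0 ≤ ∑ j, φs i j k' := Finset.sum_nonneg fun j _ => (hφ i j k').1
      simp only [hydef]
      rw [sub_sub_eq_add_sub, add_sub_right_comm, hbal']
      split_ifs with h1 h2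
      · subst h1 h2; exact hρs
      · simpa using h0
      · simpa using h0
    · intro a b k'
      simp only [hf]
      have h0 := mul_nonneg (htraffic a k').1 (hφ a b k').1
      split_ifs with h1
      · subst h1
        have h2 := mul_le_mul_of_nonneg_left (hK a b) hs0.le
        have h3 := mul_le_mul_of_nonneg_right hsK h0
        linarith
      · linarith
    · intro a b k' hE
      simp [hf, hφE a b k' hE, hgE a b hE]
    · intro i k'
      simp only [htdef, hf]
      rw [(htraffic i k').2, Finset.sum_add_distrib, add_assoc]
      split_ifs <;> simp [Finset.mul_sum]
    · intro i k'
      have h1 : ((if i ∈ S k' then 0 else 1) - y i k') = ∑ j, φs i j k' +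
          if k' = k then (if i = i₀ then η s else 0) else 0 := by
        rw [← hbal']; simp only [hydef]; ring
      rw [h1]
      simp only [hf, htdef, Finset.sum_add_distrib, ← Finset.mul_sum]
      by_cases hk : k' = k
      · subst hk
        have h2 := hcs i
        simp only [if_true, ← Finset.mul_sum]
        rw [h2]
        split_ifs with h3
        · subst h3; ring
        · ring
      · simp [hk, mul_comm])
  have h1 : (∑ a, ∑ b, if E a b then D' a b (linkFlow φs ts a b) * g b a else 0)
      = ∑ a, ∑ b, g a b * D' b a (linkFlow φs ts b a) := by
    rw [Finset.sum_comm]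
    refine Finset.sum_congr rfl fun a _ => Finset.sum_congr rfl fun b _ => ?_
    split_ifs with hE
    · ring
    · simp [hgE a b fun h => hE (hEsymm a b h)]
  have h2 : ∑ i, B' i (cacheSize ys i) * (-(if i = i₀ then d else 0))
      = -(d * B' i₀ (cacheSize ys i₀)) := by
    simp [mul_comm]
  rw [h1, h2] at hnonneg
  linarith

/-- First-order optimality at a node `i₀` with positive traffic: `β` units of traffic are moved
from the cache of `i₀` to the flow `g`. -/
lemma first_order_condition_of_traffic_pos [Fintype V] [Fintype C] [DecidableEq V]
    {E : V → V → Prop} [DecidableRel E] (hEsymm : ∀ i j, E i j → E j i)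
    (hN : ∀ i, ∃ j, E i j)
    {S : C → Finset V} {r : V → C → ℝ} (hr : ∀ i k, 0 ≤ r i k)
    {D D' : V → V → ℝ → ℝ} {B B' : V → ℝ → ℝ}
    (hD : LinkCostReg D D') (hB : CacheCostReg B B')
    {φs : V → V → C → ℝ} {ys : V → C → ℝ} {ts : V → C → ℝ}
    (hfeas : Feasible E S φs ys) (htraffic : TrafficEq r φs ts)
    (hopt : ∀ (φ' : V → V → C → ℝ) (y' : V → C → ℝ) (t' : V → C → ℝ),
      Feasible E S φ' y' → TrafficEq r φ' t' →
      totalCost E D B φs ys ts ≤ totalCost E D B φ' y' t')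
    (k : C) {i₀ : V} (ht : 0 < ts i₀ k) {g : V → V → ℝ} {β K : ℝ}
    (hgE : ∀ a b, ¬ E a b → g a b = 0)
    (hK : ∀ a b, -(K * (ts a k * φs a b k)) ≤ g a b)
    (hy : β ≤ 0 ∨ 0 < ys i₀ k) (hρ : 0 ≤ β ∨ 0 < ∑ j, φs i₀ j k)
    (hcons : ∀ i, ∑ b, g i b = (∑ j, φs i j k) * ∑ l, g l i + if i = i₀ then β else 0) :
    β / ts i₀ k * B' i₀ (cacheSize ys i₀) ≤
      ∑ a, ∑ b, g a b * D' b a (linkFlow φs ts b a) := by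
  set w : ℝ := ∑ l, g l i₀
  set η : ℝ → ℝ := fun s => s * β / (ts i₀ k + s * w) with hηdef
  have hden : HasDerivAt (fun s : ℝ => ts i₀ k + s * w) w 0 := by
    simpa using ((hasDerivAt_id (0 : ℝ)).mul_const w).const_add (ts i₀ k)
  have hη : HasDerivAt η (β / ts i₀ k) 0 := by
    have hnum : HasDerivAt (fun s : ℝ => s * β) β 0 := by
      simpa using (hasDerivAt_id (0 : ℝ)).mul_const β
    have hval : β / ts i₀ k = (β * (ts i₀ k + 0 * w) - 0 * β * w) / (ts i₀ k + 0 * w) ^ 2 := by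
      simp only [zero_mul, add_zero, sub_zero]
      field_simp
    rw [hval]
    exact hnum.fun_div hden (by simpa using ht.ne')
  have hη0 : η 0 = 0 := by simp [hηdef]
  have hdenpos : ∀ᶠ s in 𝓝[>] (0 : ℝ), 0 < ts i₀ k + s * w := by
    refine (hden.continuousAt.eventually_const_lt ?_).filter_mono nhdsWithin_le_nhds
    simpa using ht
  have hηtendsto : Tendsto η (𝓝[>] 0) (𝓝 0) := by
    have := hη.continuousAt.tendsto
    rw [hη0] at this
    exact this.mono_left nhdsWithin_le_nhds
  refine first_order_condition hEsymm hN hr hD hB hfeas htraffic hopt k i₀ hgE hK hη hη0 ?_ ?_ ?_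
  · rcases hy with hβ | hy
    · filter_upwards [hdenpos, self_mem_nhdsWithin] with s hs hs0
      exact (div_nonpos_of_nonpos_of_nonneg
        (mul_nonpos_of_nonneg_of_nonpos (le_of_lt hs0) hβ) hs.le).trans (hfeas.2.2.1 i₀ k).1
    · exact hηtendsto.eventually_le_const hy
  · rcases hρ with hβ | hρ
    · filter_upwards [hdenpos, self_mem_nhdsWithin] with s hs hs0
      exact add_nonneg (Finset.sum_nonneg fun j _ => (hfeas.1 i₀ j k).1)
        (div_nonneg (mul_nonneg (le_of_lt hs0) hβ) hs.le)
    · filter_upwards [hηtendsto.eventually_const_le (neg_lt_zero.2 hρ)] with s hs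
      linarith
  · filter_upwards [hdenpos] with s hs i
    rw [hcons, hηdef, div_mul_cancel₀ _ hs.ne']
    split_ifs <;> ring

/-- Unit flows, and their costs `q₀`, created by following an acyclic routing `P`. -/
lemma exists_unitFlow_of_acyclic [Fintype V] [DecidableEq V] {E : V → V → Prop}
    {P c : V → V → ℝ} (hc : ∀ i j, 0 ≤ c i j) (hP : ∀ i j, 0 ≤ P i j)
    (hPE : ∀ i j, ¬ E i j → P i j = 0)
    (hacyclic : ¬ ∃ (n : ℕ) (c : ℕ → V), 0 < n ∧ c 0 = c n ∧ ∀ l < n, 0 < P (c l) (c (l + 1)))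
    {t : V → ℝ} (ht : ∀ i, 0 ≤ t i) (htP : ∀ i, ∑ j, t j * P j i ≤ t i) :
    ∃ (x : V → V → V → ℝ) (q₀ : V → ℝ),
      (∀ j, IsUnitFlow E (fun i => ∑ j, P i j) j (x j)) ∧
      (∀ j, ∑ a, ∑ b, x j a b * c a b = q₀ j) ∧ (∀ j, 0 ≤ q₀ j) ∧
      (∀ i, q₀ i = ∑ j, P i j * (c i j + q₀ j)) ∧
      ∀ j a b, t j * x j a b ≤ Fintype.card V * (t a * P a b) := by
  obtain ⟨N, hN0, hleft, hright, hNt⟩ := exists_visit_matrix (P := P) hP hacyclic ht htP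
  have hx0 : ∀ j a b, 0 ≤ N j a * P a b := fun j a b => mul_nonneg (hN0 j a) (hP a b)
  refine ⟨fun j a b => N j a * P a b, fun j => ∑ a, ∑ b, N j a * P a b * c a b,
    fun j => ⟨hx0 j, fun a b hab => by simp [hPE a b hab], fun i => ?_⟩, fun j => rfl,
    fun j => Finset.sum_nonneg fun a _ => Finset.sum_nonneg fun b _ =>
      mul_nonneg (hx0 j a b) (hc a b), fun i => ?_, fun j a b => ?_⟩
  · rw [← Finset.mul_sum, ← hleft, mul_comm]
  · have hcollect : ∀ j, ∑ a, ∑ b, N j a * P a b * c a b = ∑ a, N j a * ∑ b, P a b * c a b :=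
      fun j => by simp only [mul_assoc, Finset.mul_sum]
    simp only [hcollect, mul_add, Finset.sum_add_distrib]
    conv_lhs => enter [2, a]; rw [hright i a, add_mul, Finset.sum_mul]
    rw [Finset.sum_add_distrib, Finset.sum_comm (γ := V)]
    simp [Finset.mul_sum, mul_assoc]
  · calc t j * (N j a * P a b) = t j * N j a * P a b := by ring
      _ ≤ Fintype.card V * t a * P a b := mul_le_mul_of_nonneg_right (hNt j a) (hP a b)
      _ = Fintype.card V * (t a * P a b) := by ring

/-- Marginal costs of one item at a first-order stationary point: they solve the Bellman equation
at every node, and the routing and caching of nodes with positive traffic are tight. -/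
lemma exists_tight_bellman_solution [Fintype V] [DecidableEq V] {E : V → V → Prop}
    (hN : ∀ i, ∃ j, E i j) {P c : V → V → ℝ} {t y M : V → ℝ}
    (hc : ∀ i j, 0 ≤ c i j) (hP : ∀ i j, 0 ≤ P i j) (hPE : ∀ i j, ¬ E i j → P i j = 0)
    (hacyclic : ¬ ∃ (n : ℕ) (c : ℕ → V), 0 < n ∧ c 0 = c n ∧ ∀ l < n, 0 < P (c l) (c (l + 1)))
    (ht : ∀ i, 0 ≤ t i) (htP : ∀ i, ∑ j, t j * P j i ≤ t i)
    (hstat : ∀ i₀, 0 < t i₀ → ∀ (g : V → V → ℝ) (β K : ℝ), (∀ a b, ¬ E a b → g a b = 0) →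
      (∀ a b, -(K * (t a * P a b)) ≤ g a b) → (β ≤ 0 ∨ 0 < y i₀) → (0 ≤ β ∨ 0 < ∑ j, P i₀ j) →
      (∀ i, ∑ b, g i b = (∑ j, P i j) * ∑ l, g l i + if i = i₀ then β else 0) →
      β / t i₀ * M i₀ ≤ ∑ a, ∑ b, g a b * c a b) :
    ∃ (q : V → ℝ) (next : V → V),
      (∀ i, E i (next i)) ∧
      (∀ i j, E i j → c i (next i) + q (next i) ≤ c i j + q j) ∧
      (∀ i, q i = (∑ j, P i j) * (c i (next i) + q (next i))) ∧
      (∀ i j, 0 < t i → 0 < P i j → c i j + q j = c i (next i) + q (next i)) ∧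
      (∀ i j, 0 < t i → 0 < P i j → c i (next i) + q (next i) ≤ M i / t i) ∧
      ∀ i, 0 < t i → 0 < y i → M i / t i ≤ c i (next i) + q (next i) := by
  have hρ : ∀ i, 0 ≤ ∑ j, P i j := fun i => Finset.sum_nonneg fun j _ => hP i j
  obtain ⟨x, q₀, hx, hxq, hq₀, hrec, hxt⟩ := exists_unitFlow_of_acyclic hc hP hPE hacyclic ht htP
  obtain ⟨q, next, hnE, hnmin, hbell, hle, hge⟩ := exists_bellman_solution hN hc hP hPE hq₀ hrec
  have hflow : ∀ {i v}, PolicyCost E c (fun i => ∑ j, P i j) q₀ i v → _ := fun h =>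
    h.exists_unitFlow hρ fun j => ⟨x j, hx j, hxq j⟩
  have hEP : ∀ i j, 0 < P i j → E i j := fun i j h => by
    by_contra hE
    exact h.ne' (hPE i j hE)
  have hbound : ∀ i j, 0 < t i → 0 < P i j →
      ∃ K, ∀ a b, prependLink i j (x j) a b ≤ K * (t a * P a b) := by
    intro i j hti hPij
    have hlow : t i * P i j ≤ t j := (Finset.single_le_sum (f := fun i => t i * P i j)
      (fun i _ => mul_nonneg (ht i) (hP i j)) (Finset.mem_univ i)).trans (htP j)
    have hpos := mul_pos hti hPij
    have htj : 0 < t j := hpos.trans_le hlow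
    refine ⟨1 / (t i * P i j) + Fintype.card V / t j, fun a b => ?_⟩
    rw [add_mul]
    refine add_le_add ?_ ?_
    · split_ifs with h
      · rw [h.1, h.2, one_div_mul_cancel hpos.ne']
      · exact mul_nonneg (by positivity) (mul_nonneg (ht a) (hP a b))
    · rw [div_mul_eq_mul_div, le_div_iff₀' htj]
      exact hxt j a b
  have hreroute : ∀ i j j', 0 < t i → 0 < P i j → E i j' → c i j + q₀ j ≤ c i j' + q j' := by
    intro i j j' hti hPij hE'
    rw [← sub_le_iff_le_add']
    refine hge j' _ fun v hv => ?_
    obtain ⟨x', hx', hxv⟩ := hflow hv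
    obtain ⟨K, hK⟩ := hbound i j hti hPij
    have h := hstat i hti (fun a b => prependLink i j' x' a b - prependLink i j (x j) a b) 0 K
      (fun a b hab => by
        rw [hx'.prependLink_supp hE' hab, (hx j).prependLink_supp (hEP i j hPij) hab, sub_zero])
      (fun a b => by linarith [hx'.prependLink_nonneg (i := i) a b, hK a b])
      (Or.inl le_rfl) (Or.inl le_rfl)
      (fun a => by
        simp only [Finset.sum_sub_distrib, hx'.sum_prependLink, (hx j).sum_prependLink, ite_self]
        ring)
    simp only [sub_mul, Finset.sum_sub_distrib, sum_prependLink_mul, hxv, hxq, zero_div,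
      zero_mul] at h
    linarith
  have htight : ∀ i j, 0 < t i → 0 < P i j → c i j + q₀ j = c i (next i) + q (next i) :=
    fun i j hti hPij => le_antisymm (hreroute i j _ hti hPij (hnE i))
      ((hnmin i j (hEP i j hPij)).trans (by linarith [hle j]))
  refine ⟨q, next, hnE, hnmin, hbell, fun i j hti hPij => ?_, fun i j hti hPij => ?_,
    fun i hti hyi => ?_⟩
  · refine le_antisymm ?_ (hnmin i j (hEP i j hPij))
    linarith [htight i j hti hPij, hle j]
  · obtain ⟨K, hK⟩ := hbound i j hti hPij
    have h := hstat i hti (fun a b => - prependLink i j (x j) a b) (-1) K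
      (fun a b hab => by rw [(hx j).prependLink_supp (hEP i j hPij) hab, neg_zero])
      (fun a b => neg_le_neg (hK a b)) (Or.inl (by norm_num))
      (Or.inr (hPij.trans_le (Finset.single_le_sum (fun j _ => hP i j) (Finset.mem_univ j))))
      (fun a => by
        simp only [Finset.sum_neg_distrib, (hx j).sum_prependLink]
        split_ifs <;> ring)
    simp only [neg_mul, Finset.sum_neg_distrib, sum_prependLink_mul, hxq] at h
    rw [← htight i j hti hPij]
    have h' : -1 / t i * M i = -(M i / t i) := by ring
    linarith
  · rw [← sub_le_iff_le_add']
    refine hge _ _ fun v hv => ?_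
    obtain ⟨x', hx', hxv⟩ := hflow hv
    have h := hstat i hti (prependLink i (next i) x') 1 0
      (fun a b hab => hx'.prependLink_supp (hnE i) hab)
      (fun a b => by simpa using hx'.prependLink_nonneg a b) (Or.inr hyi) (Or.inl zero_le_one)
      (fun a => by rw [hx'.sum_prependLink, add_comm])
    rw [sum_prependLink_mul, hxv, one_div_mul_eq_div] at h
    linarith

/-- Corollary 1: for any loop-free global optimum `(φ*,y*)` there is a
strategy `(φ,y)` satisfying the modified optimality condition with `y = y*`, agreeing with
`φ*` wherever `t*_i(k) > 0`, and with the same (optimal) total cost. -/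
theorem modified_condition_attained_at_optimum
    {V C : Type*} [Fintype V] [Fintype C] [DecidableEq V]
    (E : V → V → Prop) [DecidableRel E] (hEsymm : ∀ i j, E i j → E j i)
    (hN : ∀ i, ∃ j, E i j)
    (S : C → Finset V) (r : V → C → ℝ) (hr : ∀ i k, 0 ≤ r i k)
    (D D' : V → V → ℝ → ℝ) (B B' : V → ℝ → ℝ)
    (hD : LinkCostReg D D') (hB : CacheCostReg B B')
    (φs : V → V → C → ℝ) (ys : V → C → ℝ) (ts : V → C → ℝ)
    (hfeas : Feasible E S φs ys) (htraffic : TrafficEq r φs ts)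
    (hloopfree : LoopFree φs)
    (hopt : ∀ (φ' : V → V → C → ℝ) (y' : V → C → ℝ) (t' : V → C → ℝ),
      Feasible E S φ' y' → TrafficEq r φ' t' →
      totalCost E D B φs ys ts ≤ totalCost E D B φ' y' t') :
    ∃ (φ : V → V → C → ℝ) (y : V → C → ℝ) (t q δ : V → C → ℝ),
      Feasible E S φ y ∧ TrafficEq r φ t ∧ MarginalEq E D' φ t q ∧
      IsDelta E D' B' φ y t q δ ∧ CacheCond B' y t δ ∧ RouteCond E D' φ t q δ ∧
      y = ys ∧
      (∀ i k, 0 < ts i k → ∀ j, φ i j k = φs i j k) ∧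
      totalCost E D B φ y t = totalCost E D B φs ys ts := by
  obtain ⟨hφ, hφE, hys, hbal⟩ := id hfeas
  have hts : ∀ i k, 0 ≤ ts i k := fun i k => (htraffic i k).1
  set c : V → V → ℝ := fun i j => D' j i (linkFlow φs ts j i)
  have hc : ∀ i j, 0 ≤ c i j := fun i j =>
    deriv_nonneg_of_monotoneOn_Ici ((hD j i).1 _) (hD j i).2.1
      (Finset.sum_nonneg fun k _ => mul_nonneg (hts i k) (hφ i j k).1)
  have hM : ∀ i, 0 ≤ B' i (cacheSize ys i) := fun i =>
    deriv_nonneg_of_monotoneOn_Ici ((hB i).1 _) (hB i).2.1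
      (Finset.sum_nonneg fun k _ => (hys i k).1)
  have hitem := fun k => exists_tight_bellman_solution (P := fun i j => φs i j k) (c := c)
    (t := fun i => ts i k) (y := fun i => ys i k) (M := fun i => B' i (cacheSize ys i)) hN hc
    (fun i j => (hφ i j k).1) (fun i j => hφE i j k) (hloopfree k) (fun i => hts i k)
    (fun i => by linarith [(htraffic i k).2, hr i k])
    (fun i₀ ht g β K h1 h2 h3 h4 h5 => first_order_condition_of_traffic_pos hEsymm hN hr hD hB
      hfeas htraffic hopt k ht h1 h2 h3 h4 h5)
  choose q next hnE hnmin hbell htight hroute hcache using hitem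
  set m : V → C → ℝ := fun i k => c i (next k i) + q k (next k i)
  have hidle : ∀ i k, ts i k = 0 → 0 < ys i k → B' i (cacheSize ys i) = 0 := by
    intro i k ht hy
    refine le_antisymm ?_ (hM i)
    have h := first_order_condition hEsymm hN hr hD hB hfeas htraffic hopt k i (g := fun _ _ => 0)
      (η := id) (d := 1) (K := 0) (by simp) (by simp) (hasDerivAt_id 0) rfl
      ((eventually_le_nhds hy).filter_mono nhdsWithin_le_nhds)
      (by
        filter_upwards [self_mem_nhdsWithin] with s hs
        exact add_nonneg (Finset.sum_nonneg fun j _ => (hφ i j k).1) (le_of_lt hs))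
      (by simp [ht])
    simpa using h
  have hInf : ∀ i k, sInf {x : ℝ | ∃ j, E i j ∧ x = c i j + q k j} = m i k := fun i k =>
    IsLeast.csInf_eq ⟨⟨_, hnE k i, rfl⟩, by rintro _ ⟨j, hj, rfl⟩; exact hnmin k i j hj⟩
  set φ : V → V → C → ℝ := fun i j k =>
    if ts i k = 0 then (if j = next k i then ∑ l, φs i l k else 0) else φs i j k with hφdef
  have hsum : ∀ i k, ∑ j, φ i j k = ∑ j, φs i j k := fun i k => by
    by_cases h : ts i k = 0 <;> simp [hφdef, h]
  have hmul : ∀ i j k, ts i k * φ i j k = ts i k * φs i j k := fun i j k => by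
    by_cases h : ts i k = 0 <;> simp [hφdef, h]
  have hflow : ∀ a b, linkFlow φ ts a b = linkFlow φs ts a b := fun a b => by
    simp only [linkFlow, hmul]
  have hφ0 : ∀ i j k, 0 ≤ φ i j k := fun i j k => by
    simp only [hφdef]
    split_ifs
    exacts [Finset.sum_nonneg fun l _ => (hφ i l k).1, le_rfl, (hφ i j k).1]
  have hφE' : ∀ i j k, ¬ E i j → φ i j k = 0 := fun i j k hE => by
    have : j ≠ next k i := by rintro rfl; exact hE (hnE k i)
    simp [hφdef, this, hφE i j k hE]
  have hφm : ∀ i j k, 0 < φ i j k → c i j + q k j = m i k := fun i j k hpos => by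
    simp only [hφdef] at hpos
    split_ifs at hpos with ht hj
    · rw [hj]
    · exact absurd hpos (lt_irrefl 0)
    · exact htight k i j ((hts i k).lt_of_ne' ht) hpos
  set δ : V → C → ℝ := fun i k =>
    if 0 < ts i k then min (B' i (cacheSize ys i) / ts i k) (m i k) else m i k with hδdef
  have hδpos : ∀ i k, 0 < ts i k → δ i k = min (B' i (cacheSize ys i) / ts i k) (m i k) :=
    fun i k h => if_pos h
  have hδm : ∀ i k, δ i k ≤ m i k := fun i k => by
    simp only [hδdef]
    split_ifs
    exacts [min_le_right _ _, le_rfl]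
  refine ⟨φ, ys, ts, fun i k => q k i, δ, ⟨fun i j k => ⟨hφ0 i j k, ?_⟩, hφE', hys, fun i k => ?_⟩,
    fun i k => ⟨hts i k, ?_⟩, fun i k => ?_, fun i k => ⟨fun ht => ?_, fun ht => ?_⟩,
    fun i k => ⟨fun hy => ?_, fun _ => ?_⟩, fun i k j hE => ⟨fun hpos => ?_, fun _ => ?_⟩, rfl,
    fun i k ht j => ?_, ?_⟩
  · have h1 := Finset.single_le_sum (f := fun j => φ i j k) (fun j _ => hφ0 i j k)
      (Finset.mem_univ j)
    have h2 : (if i ∈ S k then (0 : ℝ) else 1) ≤ 1 := by split_ifs <;> norm_num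
    linarith [hsum i k, hbal i k, (hys i k).1]
  · rw [hsum, hbal]
  · simp only [hmul]; exact (htraffic i k).2
  · beta_reduce
    rw [hbell k i, ← hsum, Finset.sum_mul]
    refine Finset.sum_congr rfl fun j _ => ?_
    rw [hflow]
    split_ifs with hE
    · rcases (hφ0 i j k).eq_or_lt with h | h
      · rw [← h, zero_mul, zero_mul]
      · exact congrArg _ (hφm i j k h).symm
    · rw [hφE' i j k hE, zero_mul]
  · simp only [hflow]
    rw [hδpos i k ht, hInf]
  · simp only [hflow]
    rw [hInf]
    simp [hδdef, ht]
  · rcases (hts i k).eq_or_lt with ht | ht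
    · rw [← ht, zero_mul, hidle i k ht.symm hy]
    · rw [hδpos i k ht, min_eq_left (hcache k i ht hy), mul_div_cancel₀ _ ht.ne']
  · rcases (hts i k).eq_or_lt with ht | ht
    · rw [← ht, zero_mul]; exact hM i
    · rw [hδpos i k ht, ← le_div_iff₀' ht]
      exact min_le_left _ _
  · rw [hflow]
    refine (hφm i j k hpos).trans ?_
    by_cases ht : 0 < ts i k
    · rw [hδpos i k ht, min_eq_right]
      simp only [hφdef, ht.ne', if_false] at hpos
      exact hroute k i j ht hpos
    · simp [hδdef, ht]
  · rw [hflow]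
    exact (hδm i k).trans (hnmin k i j hE)
  · simp [hφdef, ht.ne']
  · simp only [totalCost, hflow]
end
end

section
/- Let (φ,y) be a feasible strategy satisfying the modified optimality condition, and let (φ†,y†) be any feasible strategy such that either φ†_ij(k) ≥ φ_ij(k) for all i,j,k, or φ†_ij(k) ≤ φ_ij(k) for all i,j,k (elementwise comparison of routing variables). Then T(φ,y) ≤ T(φ†,y†). -/
open Finset

noncomputable section

variable {V C : Type*}

/-- A nonnegative function that is subinvariant for a substochastic kernel vanishes wherever the
kernel loses mass. -/
lemma subinvariant_mul_leak_eq_zero {V : Type*} [Fintype V] (P : V → V → ℝ) (d : V → ℝ)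
    (hP : ∀ i, ∑ j, P i j ≤ 1) (hd : ∀ i, 0 ≤ d i) (hsub : ∀ i, d i ≤ ∑ j, d j * P j i) (i : V) :
    d i * (1 - ∑ j, P i j) = 0 := by
  have hnn : ∀ i ∈ Finset.univ, 0 ≤ d i * (1 - ∑ j, P i j) := fun i _ =>
    mul_nonneg (hd i) (sub_nonneg.2 (hP i))
  have hle : ∑ i, d i ≤ ∑ i, ∑ j, d i * P i j := by
    rw [Finset.sum_comm]
    exact Finset.sum_le_sum fun i _ => hsub i
  have hsum : ∑ i, d i * (1 - ∑ j, P i j) = 0 := by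
    refine le_antisymm ?_ (Finset.sum_nonneg hnn)
    simp only [mul_sub, mul_one, Finset.sum_sub_distrib, Finset.mul_sum]
    linarith
  exact (Finset.sum_eq_zero_iff_of_nonneg hnn).1 hsum i (Finset.mem_univ i)

/-- If the routing `P` is dominated by `Q`, traffic can only be larger under `P` than under `Q` at
nodes where `P` loses no mass. -/
lemma traffic_excess_mul_leak_eq_zero {V : Type*} [Fintype V] (P Q : V → V → ℝ) (r u w : V → ℝ)
    (hP0 : ∀ i j, 0 ≤ P i j) (hP : ∀ i, ∑ j, P i j ≤ 1) (hPQ : ∀ i j, P i j ≤ Q i j)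
    (hw0 : ∀ i, 0 ≤ w i) (hu : ∀ i, u i = r i + ∑ j, u j * P j i)
    (hw : ∀ i, w i = r i + ∑ j, w j * Q j i) (i : V) :
    max (u i - w i) 0 * (1 - ∑ j, P i j) = 0 := by
  refine subinvariant_mul_leak_eq_zero P (fun i => max (u i - w i) 0) hP
    (fun i => le_max_right _ _) (fun i => max_le ?_ ?_) i
  · have : u i - w i = ∑ j, (u j * P j i - w j * Q j i) := by
      rw [Finset.sum_sub_distrib, hu i, hw i]; ring
    rw [this]
    refine Finset.sum_le_sum fun j _ => ?_
    have h1 := mul_le_mul_of_nonneg_left (hPQ j i) (hw0 j)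
    have h2 := mul_le_mul_of_nonneg_right (le_max_left (u j - w j) 0) (hP0 j i)
    linarith
  · exact Finset.sum_nonneg fun j _ => mul_nonneg (le_max_right _ _) (hP0 j i)

/-- Summation by parts along the traffic equations: routing costs `c` and potentials `p`. -/
lemma sum_traffic_cost {V : Type*} [Fintype V] (c P : V → V → ℝ) (r u p : V → ℝ)
    (hu : ∀ i, u i = r i + ∑ j, u j * P j i) :
    ∑ i, ∑ j, c i j * (u i * P i j) =
      ∑ i, u i * (∑ j, P i j * (c i j + p j) - p i) + ∑ i, r i * p i := by
  have h1 : ∑ i, u i * p i = ∑ i, r i * p i + ∑ i, ∑ j, u i * P i j * p j := by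
    rw [Finset.sum_comm (f := fun i j => u i * P i j * p j), ← Finset.sum_add_distrib]
    refine Finset.sum_congr rfl fun i _ => ?_
    rw [← Finset.sum_mul, ← add_mul, ← hu i]
  have h2 : ∑ i, u i * (∑ j, P i j * (c i j + p j) - p i) =
      ∑ i, ∑ j, c i j * (u i * P i j) + ∑ i, ∑ j, u i * P i j * p j - ∑ i, u i * p i := by
    rw [← Finset.sum_add_distrib, ← Finset.sum_sub_distrib]
    refine Finset.sum_congr rfl fun i _ => ?_
    rw [← Finset.sum_add_distrib, mul_sub, Finset.mul_sum]
    congr 1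
    exact Finset.sum_congr rfl fun j _ => by ring
  linarith

/-- First-order optimality, for a single item, of a strategy satisfying the modified condition
against comparable strategies. The potentials `q` may be negative on closed routing classes, so
the argument runs with their positive parts. -/
lemma single_item_variation_nonneg {V : Type*} [Fintype V] (c φ φ' : V → V → ℝ)
    (y y' t t' r q δ b s : V → ℝ) (hr : ∀ i, 0 ≤ r i) (hc : ∀ i j, 0 ≤ c i j)
    (hb : ∀ i, 0 ≤ b i) (hs : ∀ i, s i ≤ 1)
    (hφ : ∀ i j, 0 ≤ φ i j) (hφ' : ∀ i j, 0 ≤ φ' i j) (hy : ∀ i, 0 ≤ y i) (hy' : ∀ i, 0 ≤ y' i)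
    (hys : ∀ i, y i + ∑ j, φ i j = s i) (hys' : ∀ i, y' i + ∑ j, φ' i j = s i)
    (ht : ∀ i, 0 ≤ t i) (ht' : ∀ i, 0 ≤ t' i)
    (hteq : ∀ i, t i = r i + ∑ j, t j * φ j i) (hteq' : ∀ i, t' i = r i + ∑ j, t' j * φ' j i)
    (hq : ∀ i, q i = ∑ j, φ i j * (c i j + q j))
    (hroute : ∀ i j, 0 < φ i j → c i j + q j = δ i)
    (hroute' : ∀ i j, 0 < φ' i j → δ i ≤ c i j + q j)
    (hcache : ∀ i, 0 < y i → b i = t i * δ i) (hcache0 : ∀ i, t i * δ i ≤ b i)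
    (hcmp : (∀ i j, φ i j ≤ φ' i j) ∨ (∀ i j, φ' i j ≤ φ i j)) :
    0 ≤ ∑ i, ∑ j, c i j * (t' i * φ' i j) - ∑ i, ∑ j, c i j * (t i * φ i j) +
      ∑ i, b i * (y' i - y i) := by
  set p : V → ℝ := fun i => max (q i) 0
  have hp0 : ∀ i, 0 ≤ p i := fun i => le_max_right _ _
  have hpq : ∀ i, q i ≤ p i := fun i => le_max_left _ _
  have hqδ : ∀ i, q i = δ i * ∑ j, φ i j := fun i => by
    rw [hq i, Finset.mul_sum]
    refine Finset.sum_congr rfl fun j _ => ?_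
    rcases (hφ i j).eq_or_lt with h | h
    · simp [← h]
    · rw [hroute i j h, mul_comm]
  have hpδ : ∀ i, p i = max (δ i) 0 * ∑ j, φ i j := fun i => by
    have h0 : 0 ≤ ∑ j, φ i j := Finset.sum_nonneg fun j _ => hφ i j
    rw [max_mul_of_nonneg _ _ h0, ← hqδ i, zero_mul]
  have hpsub : ∀ i, 0 ≤ ∑ j, φ i j * (c i j + p j) - p i := fun i => by
    refine sub_nonneg.2 (max_le ?_ ?_)
    · rw [hq i]
      exact Finset.sum_le_sum fun j _ =>
        mul_le_mul_of_nonneg_left (by linarith [hpq j]) (hφ i j)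
    · exact Finset.sum_nonneg fun j _ => mul_nonneg (hφ i j) (add_nonneg (hc i j) (hp0 j))
  have hcost : ∑ i, ∑ j, c i j * (t i * φ i j) ≤ ∑ i, r i * p i := by
    have h1 := sum_traffic_cost c φ r t q hteq
    have h2 : ∑ i, t i * (∑ j, φ i j * (c i j + q j) - q i) = 0 :=
      Finset.sum_eq_zero fun i _ => by rw [← hq i]; ring
    rw [h1, h2, zero_add]
    exact Finset.sum_le_sum fun i _ => mul_le_mul_of_nonneg_left (hpq i) (hr i)
  have hmono : ∀ i, 0 ≤ (y' i - y i) * (t i - t' i) := fun i => by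
    rcases hcmp with h | h
    · have hle : y' i ≤ y i := by
        have := Finset.sum_le_sum fun j (_ : j ∈ Finset.univ) => h i j
        linarith [hys i, hys' i]
      have hleak := traffic_excess_mul_leak_eq_zero φ φ' r t t' hφ
        (fun i => by linarith [hys i, hs i, hy i]) h ht' hteq hteq' i
      rcases mul_eq_zero.1 hleak with h0 | h0
      · have := max_eq_right_iff.1 h0
        exact mul_nonneg_of_nonpos_of_nonpos (by linarith) this
      · have : y' i - y i = 0 := by linarith [hys i, hs i, hy' i]
        rw [this, zero_mul]
    · have hle : y i ≤ y' i := by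
        have := Finset.sum_le_sum fun j (_ : j ∈ Finset.univ) => h i j
        linarith [hys i, hys' i]
      have hleak := traffic_excess_mul_leak_eq_zero φ' φ r t' t hφ'
        (fun i => by linarith [hys' i, hs i, hy' i]) h ht hteq' hteq i
      rcases mul_eq_zero.1 hleak with h0 | h0
      · have := max_eq_right_iff.1 h0
        exact mul_nonneg (by linarith) (by linarith)
      · have : y' i - y i = 0 := by linarith [hys' i, hs i, hy i]
        rw [this, zero_mul]
  have hlocal : ∀ i, 0 ≤ t' i * (∑ j, φ' i j * (c i j + p j) - p i) + b i * (y' i - y i) :=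
      fun i => by
    set d := max (δ i) 0 with hd
    have hd0 : 0 ≤ d := le_max_right _ _
    have h1 : d * ∑ j, φ' i j ≤ ∑ j, φ' i j * (c i j + p j) := by
      rw [Finset.mul_sum]
      refine Finset.sum_le_sum fun j _ => ?_
      rcases (hφ' i j).eq_or_lt with h | h
      · simp [← h]
      · rw [mul_comm]
        refine mul_le_mul_of_nonneg_left (max_le ?_ (add_nonneg (hc i j) (hp0 j))) h.le
        linarith [hroute' i j h, hpq j]
    have h2 : t' i * (-d * (y' i - y i)) ≤ t' i * (∑ j, φ' i j * (c i j + p j) - p i) := by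
      refine mul_le_mul_of_nonneg_left ?_ (ht' i)
      rw [hpδ i, ← hd]
      have e : ∑ j, φ' i j = ∑ j, φ i j - (y' i - y i) := by linarith [hys i, hys' i]
      rw [e] at h1
      linarith
    have hbd : t i * d ≤ b i := by
      rw [hd, mul_max_of_nonneg _ _ (ht i), mul_zero]
      exact max_le (hcache0 i) (hb i)
    have h3 : 0 ≤ (y' i - y i) * (b i - t i * d) := by
      rcases (hy i).eq_or_lt with h | h
      · rw [← h, sub_zero]
        exact mul_nonneg (hy' i) (sub_nonneg.2 hbd)
      · have : b i ≤ t i * d := by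
          rw [hcache i h]
          exact mul_le_mul_of_nonneg_left (le_max_left _ _) (ht i)
        rw [sub_eq_zero.2 (le_antisymm this hbd), mul_zero]
    have h4 := mul_nonneg (hmono i) hd0
    linarith
  have hsum := Finset.sum_nonneg fun i (_ : i ∈ Finset.univ) => hlocal i
  rw [Finset.sum_add_distrib] at hsum
  have := sum_traffic_cost c φ' r t' p hteq'
  linarith

/-- The tangent line at a point of `[0, ∞)` supports a convex function on `[0, ∞)`. -/
lemma ConvexOn.tangent_le_of_hasDerivAt {f : ℝ → ℝ} {f' x z : ℝ} {s : Set ℝ}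
    (hf : ConvexOn ℝ s f) (hx : x ∈ s) (hz : z ∈ s) (hd : HasDerivAt f f' x) :
    f' * (z - x) ≤ f z - f x := by
  rcases lt_trichotomy x z with h | rfl | h
  · have := hf.le_slope_of_hasDerivAt hx hz h hd
    rwa [slope_def_field, le_div_iff₀ (sub_pos.2 h)] at this
  · simp
  · have := hf.slope_le_of_hasDerivAt hz hx h hd
    rw [slope_def_field, div_le_iff₀ (sub_pos.2 h)] at this
    linarith

lemma MonotoneOn.hasDerivAt_nonneg_of_Ici {f : ℝ → ℝ} {f' x : ℝ}
    (hf : MonotoneOn f (Set.Ici 0)) (hx : 0 ≤ x) (hd : HasDerivAt f f' x) : 0 ≤ f' := by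
  have hmono : MonotoneOn f (Set.Ici x) := hf.mono (Set.Ici_subset_Ici.2 hx)
  rw [← hd.hasDerivWithinAt.derivWithin (uniqueDiffOn_Ici x x Set.self_mem_Ici)]
  exact hmono.derivWithin_nonneg

/-- Corollary 3: if `(φ,y)` satisfies the modified condition and `(φ†,y†)`
is feasible with `φ† ≥ φ` or `φ† ≤ φ` elementwise, then `T(φ,y) ≤ T(φ†,y†)`. -/
theorem modified_condition_monotone_routing_optimality
    {V C : Type*} [Fintype V] [Fintype C] [DecidableEq V]
    (E : V → V → Prop) [DecidableRel E] (hEsymm : ∀ i j, E i j → E j i)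
    (hN : ∀ i, ∃ j, E i j)
    (S : C → Finset V) (r : V → C → ℝ) (hr : ∀ i k, 0 ≤ r i k)
    (D D' : V → V → ℝ → ℝ) (B B' : V → ℝ → ℝ)
    (hD : LinkCostReg D D') (hB : CacheCostReg B B')
    (φ : V → V → C → ℝ) (y : V → C → ℝ) (t q δ : V → C → ℝ)
    (hfeas : Feasible E S φ y) (htraffic : TrafficEq r φ t)
    (hq : MarginalEq E D' φ t q)
    (hδ : IsDelta E D' B' φ y t q δ)
    (hcache : CacheCond B' y t δ) (hroute : RouteCond E D' φ t q δ)
    (φ' : V → V → C → ℝ) (y' : V → C → ℝ) (t' : V → C → ℝ)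
    (hfeas' : Feasible E S φ' y') (htraffic' : TrafficEq r φ' t')
    (hcmp : (∀ i j k, φ i j k ≤ φ' i j k) ∨ (∀ i j k, φ' i j k ≤ φ i j k)) :
    totalCost E D B φ y t ≤ totalCost E D B φ' y' t' := by
  obtain ⟨hφ, hφE, hy, hys⟩ := hfeas
  obtain ⟨hφ', hφE', hy', hys'⟩ := hfeas'
  have hF : ∀ a b, 0 ≤ linkFlow φ t a b := fun a b =>
    Finset.sum_nonneg fun k _ => mul_nonneg (htraffic b k).1 (hφ b a k).1
  have hF' : ∀ a b, 0 ≤ linkFlow φ' t' a b := fun a b =>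
    Finset.sum_nonneg fun k _ => mul_nonneg (htraffic' b k).1 (hφ' b a k).1
  have hY : ∀ i, 0 ≤ cacheSize y i := fun i => Finset.sum_nonneg fun k _ => (hy i k).1
  have hY' : ∀ i, 0 ≤ cacheSize y' i := fun i => Finset.sum_nonneg fun k _ => (hy' i k).1
  set c : V → V → ℝ := fun i j => D' j i (linkFlow φ t j i)
  set b : V → ℝ := fun i => B' i (cacheSize y i)
  have hc0 : ∀ i j, 0 ≤ c i j := fun i j =>
    (hD j i).2.1.hasDerivAt_nonneg_of_Ici (hF j i) ((hD j i).1 _)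
  have hb0 : ∀ i, 0 ≤ b i := fun i => (hB i).2.1.hasDerivAt_nonneg_of_Ici (hY i) ((hB i).1 _)
  have hedge : ∀ {ψ : V → V → C → ℝ}, (∀ i j k, ¬ E i j → ψ i j k = 0) →
      ∀ i j k, 0 < ψ i j k → E i j := fun hψ i j k h => by
    by_contra hE
    exact h.ne' (hψ i j k hE)
  have hitem : ∀ k, 0 ≤ ∑ i, ∑ j, c i j * (t' i k * φ' i j k) -
      ∑ i, ∑ j, c i j * (t i k * φ i j k) + ∑ i, b i * (y' i k - y i k) := fun k => by
    refine single_item_variation_nonneg c (fun i j => φ i j k) (fun i j => φ' i j k)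
      (fun i => y i k) (fun i => y' i k) (fun i => t i k) (fun i => t' i k) (fun i => r i k)
      (fun i => q i k) (fun i => δ i k) b (fun i => if i ∈ S k then 0 else 1)
      (fun i => hr i k) hc0 hb0 (fun i => by split_ifs <;> norm_num)
      (fun i j => (hφ i j k).1) (fun i j => (hφ' i j k).1) (fun i => (hy i k).1)
      (fun i => (hy' i k).1) (fun i => hys i k) (fun i => hys' i k)
      (fun i => (htraffic i k).1) (fun i => (htraffic' i k).1)
      (fun i => (htraffic i k).2) (fun i => (htraffic' i k).2) (fun i => ?_)
      (fun i j h => (hroute i k j (hedge hφE i j k h)).1 h) (fun i j h => ?_)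
      (fun i => (hcache i k).1) (fun i => ?_)
      (hcmp.imp (fun h i j => h i j k) (fun h i j => h i j k))
    · rw [hq i k]
      refine Finset.sum_congr rfl fun j _ => ?_
      split_ifs with hE
      · rfl
      · rw [hφE i j k hE, zero_mul]
    · have hij := hroute i k j (hedge hφE' i j k h)
      rcases (hφ i j k).1.eq_or_lt with h0 | h0
      · exact hij.2 h0.symm
      · exact (hij.1 h0).ge
    · rcases (hy i k).1.eq_or_lt with h0 | h0
      · exact (hcache i k).2 h0.symm
      · exact ((hcache i k).1 h0).ge
  have hlink : ∀ i j, c i j * (linkFlow φ' t' j i - linkFlow φ t j i) ≤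
      (if E j i then D j i (linkFlow φ' t' j i) else 0) -
        (if E j i then D j i (linkFlow φ t j i) else 0) := fun i j => by
    split_ifs with hE
    · exact (hD j i).2.2.1.tangent_le_of_hasDerivAt (hF j i) (hF' j i) ((hD j i).1 _)
    · have hE' : ¬ E i j := fun h => hE (hEsymm i j h)
      simp [linkFlow, hφE i j _ hE', hφE' i j _ hE']
  have hcacheCost : ∀ i, b i * (cacheSize y' i - cacheSize y i) ≤
      B i (cacheSize y' i) - B i (cacheSize y i) := fun i =>
    (hB i).2.2.1.tangent_le_of_hasDerivAt (hY i) (hY' i) ((hB i).1 _)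
  have hswap : ∀ (ψ : V → V → C → ℝ) (u : V → C → ℝ),
      ∑ k, ∑ i, ∑ j, c i j * (u i k * ψ i j k) = ∑ i, ∑ j, c i j * linkFlow ψ u j i :=
    fun ψ u => by
      rw [Finset.sum_comm]
      refine Finset.sum_congr rfl fun i _ => ?_
      rw [Finset.sum_comm]
      simp only [linkFlow, Finset.mul_sum]
  have hswapB : ∑ k, ∑ i, b i * (y' i k - y i k) =
      ∑ i, b i * (cacheSize y' i - cacheSize y i) := by
    rw [Finset.sum_comm]
    simp only [cacheSize, ← Finset.sum_sub_distrib, Finset.mul_sum]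
  have htotal := Finset.sum_nonneg fun k (_ : k ∈ Finset.univ) => hitem k
  rw [Finset.sum_add_distrib, Finset.sum_sub_distrib, hswap, hswap, hswapB] at htotal
  have hlinks := Finset.sum_le_sum fun i (_ : i ∈ Finset.univ) =>
    Finset.sum_le_sum fun j (_ : j ∈ Finset.univ) => hlink i j
  have hcaches := Finset.sum_le_sum fun i (_ : i ∈ Finset.univ) => hcacheCost i
  simp only [mul_sub, Finset.sum_sub_distrib] at hlinks hcaches htotal
  rw [totalCost, totalCost, Finset.sum_comm,
    Finset.sum_comm (f := fun a b => if E a b then D a b (linkFlow φ' t' a b) else 0)]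
  linarith
end
end

section
/- Let V be a finite set, k a fixed item, r_i ≥ 0 exogenous rates, and let φ, φ† be two families of routing variables with values in [0,1] such that 0 ≤ φ_ij ≤ φ†_ij for all i,j, and such that for each of φ and φ† the support digraph (edges (i,j) with positive routing variable) is acyclic. Let t and t† be the (unique) nonnegative solutions of the traffic equations t_i = r_i + Σ_j t_j φ_ji and t†_i = r_i + Σ_j t†_j φ†_ji. Then t†_i ≥ t_i for every i, and consequently the link flows satisfy f†_ji = t†_i φ†_ij ≥ t_i φ_ij = f_ji for all i,j. -/
open Finset

/-- A relation without closed walks on a finite type is well-founded. -/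
theorem wellFounded_of_no_closed_walk {V : Type*} [Finite V] {R : V → V → Prop}
    (h : ¬ ∃ (n : ℕ) (c : ℕ → V), 0 < n ∧ c 0 = c n ∧ ∀ l < n, R (c l) (c (l + 1))) :
    WellFounded R := by
  rw [wellFounded_iff_isEmpty_descending_chain]
  refine ⟨fun ⟨s, hs⟩ => h ?_⟩
  obtain ⟨a, b, hne, hab⟩ := Finite.exists_ne_map_eq_of_infinite s
  wlog hlt : a < b generalizing a b
  · exact this b a hne.symm hab.symm (by omega)
  refine ⟨b - a, fun l => s (b - l), by omega, ?_, fun l hl => ?_⟩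
  · simp only [Nat.sub_zero, Nat.sub_sub_self hlt.le, hab]
  · have hstep := hs (b - (l + 1))
    rwa [show b - (l + 1) + 1 = b - l by omega] at hstep

/-- for a fixed item, if routing variables increase elementwise
(`0 ≤ φ ≤ φ† ≤ 1`) and both support digraphs are acyclic, then the nonnegative solutions of
the traffic equations satisfy `t† ≥ t`, and consequently all link flows satisfy
`f†_ji = t†_i φ†_ij ≥ t_i φ_ij = f_ji`. -/
theorem traffic_monotone_in_routing
    {V : Type*} [Fintype V]
    (r : V → ℝ) (hr : ∀ i, 0 ≤ r i)
    (φ φ' : V → V → ℝ)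
    (hbounds : ∀ i j, 0 ≤ φ i j ∧ φ i j ≤ φ' i j ∧ φ' i j ≤ 1)
    (hacyc : ¬ ∃ (n : ℕ) (c : ℕ → V), 0 < n ∧ c 0 = c n ∧ ∀ l < n, 0 < φ (c l) (c (l + 1)))
    (hacyc' : ¬ ∃ (n : ℕ) (c : ℕ → V), 0 < n ∧ c 0 = c n ∧ ∀ l < n, 0 < φ' (c l) (c (l + 1)))
    (t t' : V → ℝ)
    (ht : ∀ i, 0 ≤ t i ∧ t i = r i + ∑ j, t j * φ j i)
    (ht' : ∀ i, 0 ≤ t' i ∧ t' i = r i + ∑ j, t' j * φ' j i) :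
    (∀ i, t i ≤ t' i) ∧ (∀ i j, t i * φ i j ≤ t' i * φ' i j) := by
  have hwf := wellFounded_of_no_closed_walk (R := fun j i => 0 < φ j i) hacyc
  have hmono : ∀ i, t i ≤ t' i := by
    intro i
    induction i using hwf.induction with
    | _ i ih =>
      rw [(ht i).2, (ht' i).2]
      refine add_le_add_right (sum_le_sum fun j _ => ?_) _
      obtain ⟨h0, hle, -⟩ := hbounds j i
      rcases h0.eq_or_lt with h | h
      · rw [← h, mul_zero]
        exact mul_nonneg (ht' j).1 (h0.trans hle)
      · exact mul_le_mul (ih j h) hle h0 (ht' j).1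
  exact ⟨hmono, fun i j =>
    mul_le_mul (hmono i) (hbounds i j).2.1 (hbounds i j).1 (ht' i).1⟩
end

section
/- In the fixed-routing setting, the function A(y) = T(0) − Σ_{(i,j)∈E} D_ij(F_ij(y)) is nonnegative, nondecreasing in each coordinate y_i(k), and DR-submodular: all second-order cross partial derivatives are nonpositive, i.e., ∂²A/∂y_{i1}(k1)∂y_{i2}(k2) ≤ 0 for all nodes i1,i2 and items k1,k2. Moreover, B(y) = Σ_{i∈V} B_i(Σ_{k∈C} y_i(k)) is convex in y. -/
open Finset

/-- A biaffine function `a - b s - c u + d s u` of two real variables with `a, b, c, d ≥ 0`. -/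
def AlternatingBiaffine (f : ℝ → ℝ → ℝ) : Prop :=
  ∃ a b c d : ℝ, 0 ≤ a ∧ 0 ≤ b ∧ 0 ≤ c ∧ 0 ≤ d ∧
    ∀ s u, f s u = a - b * s - c * u + d * (s * u)

namespace AlternatingBiaffine

theorem zero : AlternatingBiaffine fun _ _ => 0 :=
  ⟨0, 0, 0, 0, le_rfl, le_rfl, le_rfl, le_rfl, fun _ _ => by ring⟩

theorem add {f g : ℝ → ℝ → ℝ} (hf : AlternatingBiaffine f) (hg : AlternatingBiaffine g) :
    AlternatingBiaffine fun s u => f s u + g s u := by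
  obtain ⟨a, b, c, d, ha, hb, hc, hd, h⟩ := hf
  obtain ⟨a', b', c', d', ha', hb', hc', hd', h'⟩ := hg
  exact ⟨a + a', b + b', c + c', d + d', add_nonneg ha ha', add_nonneg hb hb',
    add_nonneg hc hc', add_nonneg hd hd', fun s u => by simp only [h, h']; ring⟩

theorem const_mul {f : ℝ → ℝ → ℝ} (hf : AlternatingBiaffine f) {r : ℝ} (hr : 0 ≤ r) :
    AlternatingBiaffine fun s u => r * f s u := by
  obtain ⟨a, b, c, d, ha, hb, hc, hd, h⟩ := hf
  exact ⟨r * a, r * b, r * c, r * d, mul_nonneg hr ha, mul_nonneg hr hb,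
    mul_nonneg hr hc, mul_nonneg hr hd, fun s u => by simp only [h]; ring⟩

theorem sum {ι : Type*} (T : Finset ι) {f : ι → ℝ → ℝ → ℝ}
    (hf : ∀ j ∈ T, AlternatingBiaffine (f j)) :
    AlternatingBiaffine fun s u => ∑ j ∈ T, f j s u := by
  classical
  induction T using Finset.induction_on with
  | empty => simpa using zero
  | insert j T hj ih =>
    simp only [Finset.sum_insert hj]
    exact (hf j (Finset.mem_insert_self j T)).add
      (ih fun i hi => hf i (Finset.mem_insert_of_mem hi))

/-- A product of nonnegative constants, perturbed by `-s` in at most one factor and by `-u` in at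
most one factor. -/
theorem prod {ι : Type*} (T : Finset ι) (z : ι → ℝ) (P Q : ι → Prop)
    [DecidablePred P] [DecidablePred Q] (hz : ∀ j ∈ T, 0 ≤ z j)
    (hP : ∀ i ∈ T, ∀ j ∈ T, P i → P j → i = j) (hQ : ∀ i ∈ T, ∀ j ∈ T, Q i → Q j → i = j) :
    AlternatingBiaffine fun s u =>
      ∏ j ∈ T, (z j - (if P j then s else 0) - (if Q j then u else 0)) := by
  classical
  suffices h : ∃ a b c d : ℝ, 0 ≤ a ∧ 0 ≤ b ∧ 0 ≤ c ∧ 0 ≤ d ∧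
      ((∀ j ∈ T, ¬ P j) → b = 0 ∧ d = 0) ∧ ((∀ j ∈ T, ¬ Q j) → c = 0 ∧ d = 0) ∧
      ∀ s u, ∏ j ∈ T, (z j - (if P j then s else 0) - (if Q j then u else 0)) =
        a - b * s - c * u + d * (s * u) by
    obtain ⟨a, b, c, d, ha, hb, hc, hd, -, -, h⟩ := h
    exact ⟨a, b, c, d, ha, hb, hc, hd, h⟩
  induction T using Finset.induction_on with
  | empty => exact ⟨1, 0, 0, 0, by simp⟩
  | insert j T hj ih =>
    have hjm := Finset.mem_insert_self j T
    have hm : ∀ i ∈ T, i ∈ insert j T := fun i hi => Finset.mem_insert_of_mem hi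
    obtain ⟨a, b, c, d, ha, hb, hc, hd, hbd, hcd, h⟩ := ih (fun i hi => hz i (hm i hi))
      (fun i hi i' hi' => hP i (hm i hi) i' (hm i' hi'))
      (fun i hi i' hi' => hQ i (hm i hi) i' (hm i' hi'))
    have hzj := hz j hjm
    have noP : P j → b = 0 ∧ d = 0 := fun hp => hbd fun i hi hpi =>
      hj (hP i (hm i hi) j hjm hpi hp ▸ hi)
    have noQ : Q j → c = 0 ∧ d = 0 := fun hq => hcd fun i hi hqi =>
      hj (hQ i (hm i hi) j hjm hqi hq ▸ hi)
    simp only [Finset.prod_insert hj, h, Finset.forall_mem_insert]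
    by_cases hp : P j <;> by_cases hq : Q j
    · obtain ⟨rfl, rfl⟩ := noP hp
      obtain ⟨rfl, -⟩ := noQ hq
      exact ⟨z j * a, a, a, 0, mul_nonneg hzj ha, ha, ha, le_rfl, fun h => (h.1 hp).elim,
        fun h => (h.1 hq).elim, fun s u => by simp only [hp, hq, if_true]; ring⟩
    · obtain ⟨rfl, rfl⟩ := noP hp
      exact ⟨z j * a, a, z j * c, c, mul_nonneg hzj ha, ha, mul_nonneg hzj hc, hc,
        fun h => (h.1 hp).elim, fun h => by simp [(hcd h.2).1],
        fun s u => by simp only [hp, hq, if_true, if_false]; ring⟩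
    · obtain ⟨rfl, rfl⟩ := noQ hq
      exact ⟨z j * a, z j * b, a, b, mul_nonneg hzj ha, mul_nonneg hzj hb, ha, hb,
        fun h => by simp [(hbd h.2).1], fun h => (h.1 hq).elim,
        fun s u => by simp only [hp, hq, if_true, if_false]; ring⟩
    · exact ⟨z j * a, z j * b, z j * c, z j * d, mul_nonneg hzj ha, mul_nonneg hzj hb,
        mul_nonneg hzj hc, mul_nonneg hzj hd, fun h => by simp [hbd h.2],
        fun h => by simp [hcd h.2],
        fun s u => by simp only [hp, hq, if_false]; ring⟩

end AlternatingBiaffine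

theorem MonotoneOn.deriv_nonneg_of_Ici {f : ℝ → ℝ} {t x : ℝ} (hf : MonotoneOn f (Set.Ici t))
    (hd : DifferentiableAt ℝ f x) (hx : t ≤ x) : 0 ≤ deriv f x := by
  rw [← hd.derivWithin (uniqueDiffOn_Ici t x hx)]
  exact hf.derivWithin_nonneg

theorem ConvexOn.deriv_deriv_nonneg_of_Ici {f : ℝ → ℝ} {t x : ℝ}
    (hf : ConvexOn ℝ (Set.Ici t) f) (hd : ContDiff ℝ 2 f) (hx : t ≤ x) :
    0 ≤ deriv (deriv f) x := by
  have h1 : ContDiff ℝ 1 (deriv f) := hd.deriv'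
  exact (hf.monotoneOn_deriv fun y _ => hd.differentiable (by norm_num) y).deriv_nonneg_of_Ici
    (h1.differentiable (by norm_num) x) hx

/-- The mixed second derivative at the origin of `K - ∑ g_j ∘ f_j`, where each `g_j` is increasing
and convex on `[0, ∞)` and each `f_j` is biaffine with alternating signs, is nonpositive. -/
theorem deriv_deriv_sub_sum_comp_nonpos {ι : Type*} (T : Finset ι) (K : ℝ) (g : ι → ℝ → ℝ)
    (f : ι → ℝ → ℝ → ℝ) (hg : ∀ j ∈ T, ContDiff ℝ 2 (g j))
    (hmono : ∀ j ∈ T, MonotoneOn (g j) (Set.Ici 0))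
    (hconv : ∀ j ∈ T, ConvexOn ℝ (Set.Ici 0) (g j))
    (hf : ∀ j, AlternatingBiaffine (f j)) :
    deriv (fun s => deriv (fun u => K - ∑ j ∈ T, g j (f j s u)) 0) 0 ≤ 0 := by
  choose a b c d ha hb hc hd hf using hf
  have hdiff : ∀ j ∈ T, Differentiable ℝ (g j) := fun j hj =>
    (hg j hj).differentiable (by norm_num)
  have hdiff' : ∀ j ∈ T, Differentiable ℝ (deriv (g j)) := fun j hj =>
    ((hg j hj).deriv' : ContDiff ℝ 1 _).differentiable (by norm_num)
  have inner : ∀ s, deriv (fun u => K - ∑ j ∈ T, g j (f j s u)) 0 =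
      - ∑ j ∈ T, deriv (g j) (a j - b j * s) * (d j * s - c j) := by
    intro s
    refine HasDerivAt.deriv (HasDerivAt.const_sub K (HasDerivAt.fun_sum fun j hj => ?_))
    have haff : HasDerivAt (f j s) (d j * s - c j) 0 := by
      have := ((hasDerivAt_id (0 : ℝ)).mul_const (d j * s - c j)).const_add (a j - b j * s)
      rw [one_mul] at this
      refine this.congr_of_eventuallyEq (.of_forall fun u => ?_)
      simp only [hf, id]
      ring
    have hval : f j s 0 = a j - b j * s := by rw [hf]; ring
    have := (hdiff j hj (f j s 0)).hasDerivAt.comp (0 : ℝ) haff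
    rwa [hval] at this
  simp only [inner]
  have outer : HasDerivAt
      (fun s => - ∑ j ∈ T, deriv (g j) (a j - b j * s) * (d j * s - c j))
      (- ∑ j ∈ T, (deriv (deriv (g j)) (a j) * (b j * c j) + deriv (g j) (a j) * d j)) 0 := by
    refine (HasDerivAt.fun_sum fun j hj => ?_).neg
    have h1 : HasDerivAt (fun s => a j - b j * s) (-b j) 0 := by
      simpa using ((hasDerivAt_id (0 : ℝ)).const_mul (b j)).const_sub (a j)
    have h2 : HasDerivAt (fun s => d j * s - c j) (d j) 0 := by
      simpa using ((hasDerivAt_id (0 : ℝ)).const_mul (d j)).sub_const (c j)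
    have h3 := ((hdiff' j hj (a j - b j * 0)).hasDerivAt.comp (0 : ℝ) h1).mul h2
    refine h3.congr_deriv ?_
    simp only [Function.comp_apply, mul_zero, sub_zero, zero_sub]
    ring
  rw [outer.deriv, neg_nonpos]
  exact Finset.sum_nonneg fun j hj => add_nonneg
    (mul_nonneg ((hconv j hj).deriv_deriv_nonneg_of_Ici (hg j hj) (ha j))
      (mul_nonneg (hb j) (hc j)))
    (mul_nonneg ((hmono j hj).deriv_nonneg_of_Ici (hdiff j hj _) (ha j)) (hd j))

/-- Lemma 1: in the fixed-routing setting, the caching gain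
`A(y) = T(0) − ∑_{(i,j)∈E} D_ij(F_ij(y))` is nonnegative, coordinatewise nondecreasing, and
DR-submodular (all second-order cross partial derivatives are nonpositive) on `[0,1]`-valued
caching strategies, while `B(y) = ∑_i B_i(∑_k y_i(k))` is convex in `y`. -/
theorem fixed_routing_gain_DR_submodular
    {V C : Type*} [Fintype V] [Fintype C] [DecidableEq V] [DecidableEq C]
    (E : V → V → Prop) [DecidableRel E] (hEsymm : ∀ i j, E i j → E j i)
    (S : C → Finset V)
    (r : V → C → ℝ) (hr : ∀ v k, 0 ≤ r v k)
    -- the fixed routing paths `p_vk`, one per requester/item pair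
    (p : V → C → List V)
    (hne : ∀ v k, p v k ≠ [])
    (hhead : ∀ v k, (p v k).head? = some v)
    (hlast : ∀ v k, ∃ s ∈ S k, (p v k).getLast? = some s)
    (hnodup : ∀ v k, (p v k).Nodup)
    (hedges : ∀ v k, (p v k).Chain' E)
    (hintermediate : ∀ v k, ∀ l, l + 1 < (p v k).length → (p v k).getD l v ∉ S k)
    (D : V → V → ℝ → ℝ) (B : V → ℝ → ℝ)
    (hD : ∀ a b, ContDiff ℝ 2 (D a b) ∧ MonotoneOn (D a b) (Set.Ici 0) ∧
      ConvexOn ℝ (Set.Ici 0) (D a b) ∧ D a b 0 = 0 ∧ ∀ x, 0 ≤ x → 0 ≤ D a b x)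
    (hB : ∀ i, ContDiff ℝ 1 (B i) ∧ MonotoneOn (B i) (Set.Ici 0) ∧
      ConvexOn ℝ (Set.Ici 0) (B i) ∧ B i 0 = 0)
    -- `itemFlow y k a b` is the response flow `f_{ab}(k)` of item `k` on link `(a,b)`:
    -- `f_{ji}(k) = ∑_{v : (i,j) ∈ p_vk} r_v(k) ∏_{l'=1}^{l_{p_vk}(i)} (1 − y_{p_vk^{l'}}(k))`
    (itemFlow : (V → C → ℝ) → C → V → V → ℝ)
    (hitemFlow : ∀ y k a b, itemFlow y k a b =
      ∑ v, ∑ l ∈ Finset.range ((p v k).length - 1),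
        if (p v k).getD l v = b ∧ (p v k).getD (l + 1) v = a then
          r v k * ∏ l' ∈ Finset.range (l + 1), (1 - y ((p v k).getD l' v) k)
        else 0)
    -- the caching gain `A(y) = T(0) − ∑_{(i,j)∈E} D_ij(F_ij(y))`
    (A : (V → C → ℝ) → ℝ)
    (hA : ∀ y, A y =
      (∑ a, ∑ b, if E a b then D a b (∑ k, itemFlow (fun _ _ => 0) k a b) else 0)
        - (∑ a, ∑ b, if E a b then D a b (∑ k, itemFlow y k a b) else 0)) :
    -- nonnegativity of `A`
    (∀ y : V → C → ℝ, (∀ i k, 0 ≤ y i k ∧ y i k ≤ 1) → 0 ≤ A y) ∧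
    -- monotonicity of `A` in each coordinate
    (∀ y y' : V → C → ℝ, (∀ i k, 0 ≤ y i k) → (∀ i k, y i k ≤ y' i k) →
      (∀ i k, y' i k ≤ 1) → A y ≤ A y') ∧
    -- DR-submodularity: `∂²A/∂y_{i₁}(k₁)∂y_{i₂}(k₂) ≤ 0`
    (∀ y : V → C → ℝ, (∀ i k, 0 ≤ y i k ∧ y i k ≤ 1) → ∀ i₁ k₁ i₂ k₂,
      deriv (fun s : ℝ => deriv (fun u : ℝ =>
        A (fun i k => y i k + (if i = i₁ ∧ k = k₁ then s else 0)
            + (if i = i₂ ∧ k = k₂ then u else 0))) 0) 0 ≤ 0) ∧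
    -- convexity of `B(y)`
    ConvexOn ℝ {y : V → C → ℝ | ∀ i k, 0 ≤ y i k ∧ y i k ≤ 1}
      (fun y => ∑ i, B i (∑ k, y i k)) := by
  have hflow_nonneg : ∀ y : V → C → ℝ, (∀ i k, y i k ≤ 1) → ∀ k a b, 0 ≤ itemFlow y k a b := by
    intro y hy k a b
    rw [hitemFlow]
    refine Finset.sum_nonneg fun v _ => Finset.sum_nonneg fun l _ => ?_
    split_ifs
    · exact mul_nonneg (hr v k) (Finset.prod_nonneg fun _ _ => sub_nonneg.2 (hy _ _))
    · exact le_rfl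
  have hflow_anti : ∀ y y' : V → C → ℝ, (∀ i k, y i k ≤ y' i k) → (∀ i k, y' i k ≤ 1) →
      ∀ k a b, itemFlow y' k a b ≤ itemFlow y k a b := by
    intro y y' hyy hy' k a b
    rw [hitemFlow, hitemFlow]
    refine Finset.sum_le_sum fun v _ => Finset.sum_le_sum fun l _ => ?_
    split_ifs
    · exact mul_le_mul_of_nonneg_left (Finset.prod_le_prod (fun _ _ => sub_nonneg.2 (hy' _ _))
        fun _ _ => sub_le_sub_left (hyy _ _) 1) (hr v k)
    · exact le_rfl
  have hmono : ∀ y y' : V → C → ℝ, (∀ i k, 0 ≤ y i k) → (∀ i k, y i k ≤ y' i k) →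
      (∀ i k, y' i k ≤ 1) → A y ≤ A y' := by
    intro y y' _ hyy hy'
    rw [hA, hA]
    refine sub_le_sub_left (Finset.sum_le_sum fun a _ => Finset.sum_le_sum fun b _ => ?_) _
    split_ifs
    · exact (hD a b).2.1 (Finset.sum_nonneg fun k _ => hflow_nonneg y' hy' k a b)
        (Finset.sum_nonneg fun k _ =>
          hflow_nonneg y (fun i k => (hyy i k).trans (hy' i k)) k a b)
        (Finset.sum_le_sum fun k _ => hflow_anti y y' hyy hy' k a b)
    · exact le_rfl
  refine ⟨fun y hy => ?_, hmono, fun y hy i₁ k₁ i₂ k₂ => ?_, ?_⟩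
  · calc (0 : ℝ) = A (fun _ _ => 0) := by rw [hA, sub_self]
      _ ≤ A y := hmono _ y (fun _ _ => le_rfl) (fun i k => (hy i k).1) (fun i k => (hy i k).2)
  · have hbiaffine : ∀ e : V × V, AlternatingBiaffine fun s u =>
        ∑ k, itemFlow (fun i k => y i k + (if i = i₁ ∧ k = k₁ then s else 0)
          + (if i = i₂ ∧ k = k₂ then u else 0)) k e.1 e.2 := by
      intro e
      simp only [hitemFlow]
      refine .sum _ fun k _ => .sum _ fun v _ => .sum _ fun l hl => ?_
      by_cases he : (p v k).getD l v = e.2 ∧ (p v k).getD (l + 1) v = e.1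
      · simp only [if_pos he]
        refine AlternatingBiaffine.const_mul ?_ (hr v k)
        have hinj : ∀ m ∈ Finset.range (l + 1), ∀ n ∈ Finset.range (l + 1),
            (p v k).getD m v = (p v k).getD n v → m = n := by
          intro m hm n hn h
          rw [Finset.mem_range] at hl hm hn
          rw [List.getD_eq_getElem _ _ (by omega), List.getD_eq_getElem _ _ (by omega)] at h
          exact (hnodup v k).getElem_inj_iff.1 h
        simp only [← sub_sub]
        exact .prod _ (fun m => 1 - y ((p v k).getD m v) k) _ _
          (fun m _ => sub_nonneg.2 (hy _ _).2)
          (fun m hm n hn h h' => hinj m hm n hn (h.1.trans h'.1.symm))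
          (fun m hm n hn h h' => hinj m hm n hn (h.1.trans h'.1.symm))
      · simp only [if_neg he]
        exact .zero
    have key := deriv_deriv_sub_sum_comp_nonpos (Finset.univ.filter fun e : V × V => E e.1 e.2)
      (∑ a, ∑ b, if E a b then D a b (∑ k, itemFlow (fun _ _ => 0) k a b) else 0)
      (fun e => D e.1 e.2) _ (fun e _ => (hD e.1 e.2).1) (fun e _ => (hD e.1 e.2).2.1)
      (fun e _ => (hD e.1 e.2).2.2.1) hbiaffine
    simpa only [hA, Finset.sum_filter, Fintype.sum_prod_type] using key
  · have hbox : {y : V → C → ℝ | ∀ i k, 0 ≤ y i k ∧ y i k ≤ 1} =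
        Set.pi Set.univ fun _ => Set.pi Set.univ fun _ => Set.Icc (0 : ℝ) 1 := by
      ext y; simp only [Set.mem_ofPred_eq, Set.mem_pi, Set.mem_univ, Set.mem_Icc, true_imp_iff]
    have hconv : Convex ℝ {y : V → C → ℝ | ∀ i k, 0 ≤ y i k ∧ y i k ≤ 1} := by
      rw [hbox]
      exact convex_pi fun _ _ => convex_pi fun _ _ => convex_Icc 0 1
    refine ⟨hconv, fun x hx y hy s t hs ht hst => ?_⟩
    simp only [smul_eq_mul, Finset.mul_sum, ← Finset.sum_add_distrib]
    refine Finset.sum_le_sum fun i _ => ?_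
    have := (hB i).2.2.1.2 (Set.mem_Ici.2 (Finset.sum_nonneg fun k (_ : k ∈ univ) => (hx i k).1))
      (Set.mem_Ici.2 (Finset.sum_nonneg fun k (_ : k ∈ univ) => (hy i k).1)) hs ht hst
    simpa [Finset.mul_sum, Finset.sum_add_distrib] using this
end

section
/- Fix a node v ∈ V and hold all routing and caching variables of nodes other than v fixed, with the overall routing loop-free (for each item k, the digraph with edges (i,j) such that φ_ij(k) > 0 is acyclic). Then the total cost T = Σ_{(i,j)∈E} D_ij(F_ij) + Σ_{i∈V} B_i(Y_i) is a jointly convex function of node v's variables (φ_v, y_v) = ([φ_vj(k)]_{j,k}, [y_v(k)]_k) on the convex set of feasible values; in particular, each cache size Y_i and each total link flow F_ji is an affine function of (φ_v, y_v) when all other nodes' variables are fixed. -/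
open Finset

noncomputable section

variable {V C : Type*}

theorem exists_seq_of_transGen {α : Type*} {R : α → α → Prop} {a b : α}
    (h : Relation.TransGen R a b) :
    ∃ (n : ℕ) (c : ℕ → α), 0 < n ∧ c 0 = a ∧ c n = b ∧ ∀ l < n, R (c l) (c (l + 1)) := by
  induction h using Relation.TransGen.head_induction_on with
  | @single a h =>
    refine ⟨1, fun l => if l = 0 then a else b, one_pos, by simp, by simp, fun l hl => ?_⟩
    obtain rfl : l = 0 := by omega
    simpa using h
  | @head a m h _ ih =>
    obtain ⟨n, c, -, h0, hn, hc⟩ := ih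
    refine ⟨n + 1, fun l => Nat.casesOn l a c, n.succ_pos, rfl, hn, fun l hl => ?_⟩
    cases l with
    | zero => simpa [h0] using h
    | succ l => exact hc l (by omega)

theorem LoopFree.not_transGen {φ : V → V → C → ℝ} (h : LoopFree φ) (k : C) (a : V) :
    ¬ Relation.TransGen (fun i j => 0 < φ i j k) a a := fun hc => by
  obtain ⟨n, c, hn, h0, h1, hl⟩ := exists_seq_of_transGen hc
  exact h k ⟨n, c, hn, h0.trans h1.symm, hl⟩

/-- The support of the routing of item `k`, without the links leaving `v`. -/
def SupportOff (v : V) (φ : V → V → C → ℝ) (k : C) (i j : V) : Prop :=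
  i ≠ v ∧ 0 < φ i j k

theorem LoopFree.wellFounded_supportOff [Finite V] {φ : V → V → C → ℝ} (h : LoopFree φ)
    (v : V) (k : C) : WellFounded (SupportOff v φ k) := by
  have : Std.Irrefl (Relation.TransGen (SupportOff v φ k)) :=
    ⟨fun a ha => h.not_transGen k a (Relation.TransGen.mono (fun _ _ hij => hij.2) _ _ ha)⟩
  exact Subrelation.wf Relation.TransGen.single
    (Finite.wellFounded_of_trans_of_irrefl (Relation.TransGen (SupportOff v φ k)))

/-- Under loop-free routing, node `v` sends nothing to nodes whose traffic reaches `v`. -/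
theorem LoopFree.eq_zero_of_reflTransGen_supportOff {φ ψ : V → V → C → ℝ} {v i : V} {k : C}
    (h : LoopFree φ) (hφ : 0 ≤ φ v i k) (hagree : ∀ i ≠ v, ∀ j, ψ i j k = φ i j k)
    (hi : Relation.ReflTransGen (SupportOff v ψ k) i v) : φ v i k = 0 := by
  by_contra hne
  have hi' : Relation.ReflTransGen (fun i j => 0 < φ i j k) i v :=
    Relation.ReflTransGen.mono (fun a b hab => by
      simpa only [hagree a hab.1 b] using hab.2) _ _ hi
  exact h.not_transGen k v (.head' (lt_of_le_of_ne hφ (Ne.symm hne)) hi')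

/-- The traffic at `v` does not depend on the routing at `v`, as long as nothing sent by `v`
comes back to `v`. -/
theorem TrafficEq.eq_at_of_agree_off [Fintype V] {r : V → C → ℝ} {φ ψ : V → V → C → ℝ}
    {t s : V → C → ℝ} {v : V} {k : C} (ht : TrafficEq r φ t) (hs : TrafficEq r ψ s)
    (hwf : WellFounded (SupportOff v φ k)) (hnonneg : ∀ i j, 0 ≤ φ i j k)
    (hagree : ∀ i ≠ v, ∀ j, ψ i j k = φ i j k)
    (hφ : ∀ i, Relation.ReflTransGen (SupportOff v φ k) i v → φ v i k = 0)
    (hψ : ∀ i, Relation.ReflTransGen (SupportOff v φ k) i v → ψ v i k = 0) :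
    s v k = t v k := by
  suffices H : ∀ i, Relation.ReflTransGen (SupportOff v φ k) i v → s i k = t i k from H v .refl
  intro i
  induction i using hwf.induction with
  | h i ih =>
    intro hi
    rw [(ht i k).2, (hs i k).2]
    congr 1
    refine Finset.sum_congr rfl fun j _ => ?_
    by_cases hj : j = v
    · subst hj
      rw [hφ i hi, hψ i hi, mul_zero, mul_zero]
    · rw [hagree j hj i]
      rcases (hnonneg j i).eq_or_lt with h0 | h0
      · rw [← h0, mul_zero, mul_zero]
      · rw [ih j ⟨hj, h0⟩ (.head ⟨hj, h0⟩ hi)]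

theorem cacheSize_combo [Fintype C] (y₁ y₂ : V → C → ℝ) (θ : ℝ) (i : V) :
    cacheSize (fun i' k => θ * y₁ i' k + (1 - θ) * y₂ i' k) i
      = θ * cacheSize y₁ i + (1 - θ) * cacheSize y₂ i := by
  simp only [cacheSize, Finset.sum_add_distrib, Finset.mul_sum]

theorem totalCost_le_of_combo [Fintype V] [Fintype C] (E : V → V → Prop) [DecidableRel E]
    {D : V → V → ℝ → ℝ} {B : V → ℝ → ℝ}
    (hD : ∀ a b, ConvexOn ℝ (Set.Ici 0) (D a b)) (hB : ∀ i, ConvexOn ℝ (Set.Ici 0) (B i))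
    {φ φ₁ φ₂ : V → V → C → ℝ} {y y₁ y₂ : V → C → ℝ} {t t₁ t₂ : V → C → ℝ}
    {θ : ℝ} (hθ₀ : 0 ≤ θ) (hθ₁ : θ ≤ 1)
    (hF₁ : ∀ a b, 0 ≤ linkFlow φ₁ t₁ a b) (hF₂ : ∀ a b, 0 ≤ linkFlow φ₂ t₂ a b)
    (hY₁ : ∀ i, 0 ≤ cacheSize y₁ i) (hY₂ : ∀ i, 0 ≤ cacheSize y₂ i)
    (hF : ∀ a b, linkFlow φ t a b = θ * linkFlow φ₁ t₁ a b + (1 - θ) * linkFlow φ₂ t₂ a b)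
    (hY : ∀ i, cacheSize y i = θ * cacheSize y₁ i + (1 - θ) * cacheSize y₂ i) :
    totalCost E D B φ y t ≤ θ * totalCost E D B φ₁ y₁ t₁ + (1 - θ) * totalCost E D B φ₂ y₂ t₂ := by
  have h1 : 0 ≤ 1 - θ := sub_nonneg.2 hθ₁
  have hlink : (∑ a, ∑ b, if E a b then D a b (linkFlow φ t a b) else 0)
      ≤ θ * (∑ a, ∑ b, if E a b then D a b (linkFlow φ₁ t₁ a b) else 0)
        + (1 - θ) * (∑ a, ∑ b, if E a b then D a b (linkFlow φ₂ t₂ a b) else 0) := by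
    simp only [Finset.mul_sum, ← Finset.sum_add_distrib]
    refine Finset.sum_le_sum fun a _ => Finset.sum_le_sum fun b _ => ?_
    split_ifs
    · rw [hF]
      exact (hD a b).2 (hF₁ a b) (hF₂ a b) hθ₀ h1 (by ring)
    · simp
  have hcache : ∑ i, B i (cacheSize y i)
      ≤ θ * ∑ i, B i (cacheSize y₁ i) + (1 - θ) * ∑ i, B i (cacheSize y₂ i) := by
    simp only [Finset.mul_sum, ← Finset.sum_add_distrib]
    refine Finset.sum_le_sum fun i _ => ?_
    rw [hY]
    exact (hB i).2 (hY₁ i) (hY₂ i) hθ₀ h1 (by ring)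
  unfold totalCost
  linarith

/-- Lemma 4: with all other nodes' variables fixed and loop-free routing,
the total cost is jointly convex in node `v`'s variables `(φ_v, y_v)`; in particular the
traffic rates, cache sizes and total link flows are affine in `(φ_v, y_v)`. -/
theorem total_cost_convex_in_single_node
    {V C : Type*} [Fintype V] [Fintype C] [DecidableEq V]
    (E : V → V → Prop) [DecidableRel E] (hEsymm : ∀ i j, E i j → E j i)
    (S : C → Finset V) (r : V → C → ℝ) (hr : ∀ i k, 0 ≤ r i k)
    (D D' : V → V → ℝ → ℝ) (B B' : V → ℝ → ℝ)
    (hD : LinkCostReg D D') (hB : CacheCostReg B B')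
    (v : V)
    (φ₁ φ₂ : V → V → C → ℝ) (y₁ y₂ : V → C → ℝ)
    (hagree : ∀ i, i ≠ v → (∀ j k, φ₁ i j k = φ₂ i j k) ∧ (∀ k, y₁ i k = y₂ i k))
    (hfeas₁ : Feasible E S φ₁ y₁) (hfeas₂ : Feasible E S φ₂ y₂)
    (hloop₁ : LoopFree φ₁) (hloop₂ : LoopFree φ₂)
    (θ : ℝ) (hθ₀ : 0 ≤ θ) (hθ₁ : θ ≤ 1)
    (t₁ t₂ tθ : V → C → ℝ)
    (ht₁ : TrafficEq r φ₁ t₁) (ht₂ : TrafficEq r φ₂ t₂)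
    (htθ : TrafficEq r (fun i j k => θ * φ₁ i j k + (1 - θ) * φ₂ i j k) tθ) :
    (∀ i k, tθ i k = θ * t₁ i k + (1 - θ) * t₂ i k) ∧
    (∀ i, cacheSize (fun i' k => θ * y₁ i' k + (1 - θ) * y₂ i' k) i
        = θ * cacheSize y₁ i + (1 - θ) * cacheSize y₂ i) ∧
    (∀ a b, linkFlow (fun i j k => θ * φ₁ i j k + (1 - θ) * φ₂ i j k) tθ a b
        = θ * linkFlow φ₁ t₁ a b + (1 - θ) * linkFlow φ₂ t₂ a b) ∧
    totalCost E D B (fun i j k => θ * φ₁ i j k + (1 - θ) * φ₂ i j k)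
        (fun i' k => θ * y₁ i' k + (1 - θ) * y₂ i' k) tθ
      ≤ θ * totalCost E D B φ₁ y₁ t₁ + (1 - θ) * totalCost E D B φ₂ y₂ t₂ := by
  have hagree' : ∀ k, ∀ i ≠ v, ∀ j, φ₁ i j k = φ₂ i j k := fun k i hi j => (hagree i hi).1 j k
  have hwf := hloop₁.wellFounded_supportOff v
  have hnn₁ : ∀ i j k, 0 ≤ φ₁ i j k := fun i j k => (hfeas₁.1 i j k).1
  have hnn₂ : ∀ i j k, 0 ≤ φ₂ i j k := fun i j k => (hfeas₂.1 i j k).1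
  have hz₁ : ∀ k i, Relation.ReflTransGen (SupportOff v φ₁ k) i v → φ₁ v i k = 0 :=
    fun k i => hloop₁.eq_zero_of_reflTransGen_supportOff (hnn₁ v i k) fun _ _ _ => rfl
  have hz₂ : ∀ k i, Relation.ReflTransGen (SupportOff v φ₁ k) i v → φ₂ v i k = 0 :=
    fun k i => hloop₂.eq_zero_of_reflTransGen_supportOff (hnn₂ v i k) (hagree' k)
  have hv₂ : ∀ k, t₂ v k = t₁ v k := fun k =>
    ht₁.eq_at_of_agree_off ht₂ (hwf k) (hnn₁ · · k)
      (fun i hi j => (hagree' k i hi j).symm) (hz₁ k) (hz₂ k)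
  have hvθ : ∀ k, tθ v k = t₁ v k := fun k =>
    ht₁.eq_at_of_agree_off htθ (hwf k) (hnn₁ · · k)
      (fun i hi j => by rw [hagree' k i hi j]; ring) (hz₁ k)
      (fun i hi => by rw [hz₁ k i hi, hz₂ k i hi]; ring)
  have hterm : ∀ j k, tθ j k = θ * t₁ j k + (1 - θ) * t₂ j k → ∀ i,
      tθ j k * (θ * φ₁ j i k + (1 - θ) * φ₂ j i k)
        = θ * (t₁ j k * φ₁ j i k) + (1 - θ) * (t₂ j k * φ₂ j i k) := by
    intro j k h i
    by_cases hj : j = v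
    · subst hj
      rw [hvθ, hv₂]
      ring
    · rw [h, hagree' k j hj i]
      ring
  have ht : ∀ i k, tθ i k = θ * t₁ i k + (1 - θ) * t₂ i k := by
    intro i k
    induction i using (hwf k).induction with
    | h i ih =>
      have hsum : ∑ j, tθ j k * (θ * φ₁ j i k + (1 - θ) * φ₂ j i k)
          = θ * ∑ j, t₁ j k * φ₁ j i k + (1 - θ) * ∑ j, t₂ j k * φ₂ j i k := by
        simp only [Finset.mul_sum, ← Finset.sum_add_distrib]
        refine Finset.sum_congr rfl fun j _ => ?_
        by_cases hj : j = v
        · subst hj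
          exact hterm j k (by rw [hvθ, hv₂]; ring) i
        · rcases (hnn₁ j i k).eq_or_lt with h0 | h0
          · rw [← hagree' k j hj i, ← h0]
            ring
          · exact hterm j k (ih j ⟨hj, h0⟩) i
      rw [(htθ i k).2, hsum, (ht₁ i k).2, (ht₂ i k).2]
      ring
  have hF : ∀ a b, linkFlow (fun i j k => θ * φ₁ i j k + (1 - θ) * φ₂ i j k) tθ a b
      = θ * linkFlow φ₁ t₁ a b + (1 - θ) * linkFlow φ₂ t₂ a b := by
    intro a b
    simp only [linkFlow, Finset.mul_sum, ← Finset.sum_add_distrib]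
    exact Finset.sum_congr rfl fun k _ => hterm b k (ht b k) a
  have hY := cacheSize_combo y₁ y₂ θ
  exact ⟨ht, hY, hF, totalCost_le_of_combo E (fun a b => (hD a b).2.2.1) (fun i => (hB i).2.2.1)
    hθ₀ hθ₁ (linkFlow_nonneg hnn₁ fun i k => (ht₁ i k).1)
    (linkFlow_nonneg hnn₂ fun i k => (ht₂ i k).1)
    (cacheSize_nonneg fun i k => (hfeas₁.2.2.1 i k).1)
    (cacheSize_nonneg fun i k => (hfeas₂.2.2.1 i k).1) hF hY⟩
end
end

section
/- Suppose the routing for item k is loop-free: the digraph on the finite node set V with an edge (i,j) whenever φ_ij(k) > 0 is acyclic. Then the unique solution t of the traffic equations t_i(k) = r_i(k) + Σ_j t_j(k) φ_ji(k) admits the path-sum representation t_i(k) = Σ_{v∈V} r_v(k) · Σ_{p∈P_vi(k)} Π_{l=1}^{|p|−1} φ_{p^l p^{l+1}}(k), where P_vi(k) is the set of directed paths p = (p^1,…,p^{|p|}) with p^1 = v, p^{|p|} = i and φ_{p^l p^{l+1}}(k) > 0 for every consecutive pair (with the trivial one-node path from i to i contributing r_i(k)). -/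
open Finset

open Classical in
/-- The weights of the directed paths from `v` to `i`, extended by zero to all lists. -/
noncomputable def pathWeight {V : Type*} (f : V → V → ℝ) (v i : V) : List V → ℝ :=
  Set.indicator {p | p ≠ [] ∧ p.head? = some v ∧ p.getLast? = some i ∧
      p.IsChain (fun a b => 0 < f a b)}
    (fun p => ((p.zip p.tail).map (fun ab => f ab.1 ab.2)).prod)

theorem Relation.TransGen.exists_nat_path {V : Type*} {R : V → V → Prop} {a b : V}
    (h : Relation.TransGen R a b) :
    ∃ (n : ℕ) (c : ℕ → V), 0 < n ∧ c 0 = a ∧ c n = b ∧ ∀ l < n, R (c l) (c (l + 1)) := by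
  induction h using Relation.TransGen.head_induction_on with
  | single h =>
    rename_i a
    refine ⟨1, fun l => Nat.casesOn l a (fun _ => b), one_pos, rfl, rfl, fun l hl => ?_⟩
    obtain rfl : l = 0 := by omega
    exact h
  | head h _ ih =>
    rename_i a _ _
    obtain ⟨n, c, _, h0, hcn, hc⟩ := ih
    refine ⟨n + 1, fun l => Nat.casesOn l a c, n.succ_pos, rfl, hcn, fun l hl => ?_⟩
    cases l with
    | zero => simpa [h0] using h
    | succ l => exact hc l (by omega)

theorem List.IsChain.nodup_of_acyclic {V : Type*} {R : V → V → Prop}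
    (hacyc : ∀ a, ¬ Relation.TransGen R a a) {p : List V} (hp : p.IsChain R) : p.Nodup := by
  have hp' : p.IsChain (Relation.TransGen R) := hp.imp fun _ _ h => .single h
  refine hp'.pairwise.imp ?_
  rintro a _ h rfl
  exact hacyc a h

theorem summable_pathWeight {V : Type*} [Fintype V] {f : V → V → ℝ}
    (hacyc : ∀ a, ¬ Relation.TransGen (fun a b => 0 < f a b) a a) (v i : V) :
    Summable (pathWeight f v i) := by
  classical
  have hfin : {p : List V | p.Nodup}.Finite :=
    Set.finite_coe_iff.mp (Finite.of_fintype {p : List V // p.Nodup})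
  refine summable_of_hasFiniteSupport (hfin.subset fun p hp => ?_)
  have := Set.mem_of_indicator_ne_zero hp
  exact this.2.2.2.nodup_of_acyclic hacyc

open Classical in
theorem pathWeight_cons {V : Type*} [Fintype V] {f : V → V → ℝ} (hf : ∀ a b, 0 ≤ f a b)
    (v i : V) (l : List V) :
    pathWeight f v i (v :: l) =
      (if l = [] then if v = i then 1 else 0 else 0) + ∑ j, f v j * pathWeight f j i l := by
  cases l with
  | nil => simp [pathWeight, Set.indicator_apply]
  | cons b l =>
    rw [Finset.sum_eq_single b]
    · rcases (hf v b).eq_or_lt with h | h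
      · simp [pathWeight, Set.indicator_apply, ← h]
      · simp [pathWeight, Set.indicator_apply, h]
    · intro j _ hj
      simp [pathWeight, hj.symm]
    · simp

open Classical in
theorem tsum_pathWeight {V : Type*} [Fintype V] {f : V → V → ℝ} (hf : ∀ a b, 0 ≤ f a b)
    (hacyc : ∀ a, ¬ Relation.TransGen (fun a b => 0 < f a b) a a) (v i : V) :
    ∑' p, pathWeight f v i p =
      (if v = i then 1 else 0) + ∑ j, f v j * ∑' p, pathWeight f j i p := by
  have hinj : Function.Injective (fun l : List V => v :: l) := List.cons_injective
  rw [← hinj.tsum_eq]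
  · simp_rw [pathWeight_cons hf]
    rw [Summable.tsum_add, tsum_ite_eq, Summable.tsum_finsetSum]
    · simp_rw [tsum_mul_left]
    · exact fun j _ => (summable_pathWeight hacyc j i).mul_left _
    · exact (hasSum_ite_eq _ _).summable
    · exact summable_sum fun j _ => (summable_pathWeight hacyc j i).mul_left _
  · intro p hp
    have hp' := Set.mem_of_indicator_ne_zero hp
    cases p with
    | nil => exact absurd rfl hp'.1
    | cons a l => exact ⟨l, by simpa using hp'.2.1.symm⟩

/-- with loop-free routing for item `k`, the unique solution of the traffic
equations has the path-sum representation
`t_i(k) = ∑_v r_v(k) ∑_{p ∈ P_vi(k)} ∏_l φ_{p^l p^{l+1}}(k)`. -/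
theorem traffic_path_sum_representation
    {V C : Type*} [Fintype V]
    (k : C) (r : V → C → ℝ) (hr : ∀ i, 0 ≤ r i k)
    (φ : V → V → C → ℝ) (hφ : ∀ i j, 0 ≤ φ i j k ∧ φ i j k ≤ 1)
    (hacyc : ¬ ∃ (n : ℕ) (c : ℕ → V), 0 < n ∧ c 0 = c n ∧ ∀ l < n, 0 < φ (c l) (c (l + 1)) k)
    (t : V → C → ℝ)
    (ht : ∀ i, t i k = r i k + ∑ j, t j k * φ j i k) :
    ∀ i, t i k = ∑ v, r v k *
      ∑' p : {p : List V // p ≠ [] ∧ p.head? = some v ∧ p.getLast? = some i ∧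
          p.Chain' (fun a b => 0 < φ a b k)},
        (((p : List V).zip (p : List V).tail).map (fun ab => φ ab.1 ab.2 k)).prod := by
  classical
  intro i
  let f : V → V → ℝ := fun a b => φ a b k
  have hf : ∀ a b, 0 ≤ f a b := fun a b => (hφ a b).1
  have hcyc : ∀ a, ¬ Relation.TransGen (fun a b => 0 < f a b) a a := fun a h => by
    obtain ⟨n, c, hn, h0, hcn, hc⟩ := h.exists_nat_path
    exact hacyc ⟨n, c, hn, h0.trans hcn.symm, hc⟩
  have hr' : ∀ v, r v k = t v k - ∑ j, t j k * f j v := fun v => by linarith [ht v]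
  trans ∑ v, r v k * ∑' p, pathWeight f v i p
  · simp_rw [hr', sub_mul, Finset.sum_sub_distrib, Finset.sum_mul]
    rw [Finset.sum_comm, ← Finset.sum_sub_distrib]
    simp_rw [mul_assoc, ← Finset.mul_sum, ← mul_sub]
    have key : ∀ v, ∑' p, pathWeight f v i p - ∑ j, f v j * ∑' p, pathWeight f j i p =
        if v = i then 1 else 0 := fun v => by
      rw [sub_eq_iff_eq_add]
      exact tsum_pathWeight hf hcyc v i
    simp [key]
  · refine Finset.sum_congr rfl fun v _ => congrArg _ ?_
    exact (_root_.tsum_subtype _ _).symm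
end

section
/- Consider the two-node loop configuration with r_i > 0, r_j > 0, φ_ij > 0, φ_ji > 0 and φ_ij·φ_ji < 1, so that the loop flows f_ij = t_i·φ_ij and f_ji = t_j·φ_ji are both strictly positive. Then there exist alternative routing variables φ'_ij, φ'_ji ∈ [0,1] with φ'_ij·φ'_ji = 0 (no loop) such that the resulting flows satisfy f'_ip = f_ip and f'_jq = f_jq (external flows unchanged), while f'_ij < f_ij and f'_ji < f_ji. Consequently, for any strictly increasing link cost functions D_ij and D_ji, the total cost of the loop-free configuration is strictly smaller. -/
/-- The traffic through a node of a two-node loop with loop gain below one is positive. -/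
lemma loop_traffic_pos {r s p q t u : ℝ} (hr : 0 < r) (hs : 0 < s) (hq : 0 < q)
    (hpq : p * q < 1) (ht : t = r + q * u) (hu : u = s + p * t) : 0 < t := by
  have h : t * (1 - p * q) = r + q * s := by
    subst hu
    linear_combination ht
  have hpos : 0 < t * (1 - p * q) := by
    rw [h]
    positivity
  exact pos_of_mul_pos_left hpos (by linarith)

/-- A node with input rate `r` can forward the net loop flow `t * p - b` using a routing fraction
in `[0, 1]`, when that net flow is nonnegative. -/
lemma exists_net_routing_fraction {r p t b : ℝ} (hr : 0 < r) (ht₀ : 0 ≤ t) (hp : p ≤ 1)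
    (ht : t = r + b) (hb : b ≤ t * p) : ∃ c, 0 ≤ c ∧ c ≤ 1 ∧ r * c = t * p - b := by
  refine ⟨(t * p - b) / r, div_nonneg (by linarith) hr.le, ?_, mul_div_cancel₀ _ hr.ne'⟩
  rw [div_le_one hr]
  linarith [mul_le_of_le_one_right ht₀ hp]


/-- a strictly positive two-node routing loop can always be replaced by
loop-free routing variables which keep the external flows unchanged, strictly decrease both
loop flows, and hence strictly decrease the total cost for any strictly increasing link
costs. -/
theorem two_node_loop_removal
    (ri rj φij φji ti tj : ℝ)
    (hri : 0 < ri) (hrj : 0 < rj)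
    (hφij₀ : 0 < φij) (hφij₁ : φij ≤ 1) (hφji₀ : 0 < φji) (hφji₁ : φji ≤ 1)
    (hprod : φij * φji < 1)
    (hti : ti = ri + φji * tj) (htj : tj = rj + φij * ti) :
    ∃ φij' φji' ti' tj' : ℝ,
      0 ≤ φij' ∧ φij' ≤ 1 ∧ 0 ≤ φji' ∧ φji' ≤ 1 ∧ φij' * φji' = 0 ∧
      ti' = ri + φji' * tj' ∧ tj' = rj + φij' * ti' ∧
      ti' * (1 - φij') = ti * (1 - φij) ∧ tj' * (1 - φji') = tj * (1 - φji) ∧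
      ti' * φij' < ti * φij ∧ tj' * φji' < tj * φji ∧
      (∀ Dij Dji : ℝ → ℝ, StrictMono Dij → StrictMono Dji →
        Dij (ti' * φij') + Dji (tj' * φji') < Dij (ti * φij) + Dji (tj * φji)) := by
  have hti₀ : 0 < ti := loop_traffic_pos hri hrj hφji₀ hprod hti htj
  have htj₀ : 0 < tj := loop_traffic_pos hrj hri hφij₀ (by rwa [mul_comm]) htj hti
  have hfij : 0 < ti * φij := mul_pos hti₀ hφij₀
  have hfji : 0 < tj * φji := mul_pos htj₀ hφji₀
  rcases le_total (tj * φji) (ti * φij) with h | h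
  · obtain ⟨c, hc₀, hc₁, hc⟩ :=
      exists_net_routing_fraction hri hti₀.le hφij₁ (by linarith) h
    have hij : ri * c < ti * φij := by linarith
    have hji : (rj + c * ri) * 0 < tj * φji := by linarith
    exact ⟨c, 0, ri, rj + c * ri, hc₀, hc₁, le_rfl, zero_le_one, by ring, by ring, rfl,
      by linarith, by linarith, hij, hji, fun _ _ hD hD' => add_lt_add (hD hij) (hD' hji)⟩
  · obtain ⟨c, hc₀, hc₁, hc⟩ :=
      exists_net_routing_fraction hrj htj₀.le hφji₁ (by linarith) h
    have hij : (ri + c * rj) * 0 < ti * φij := by linarith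
    have hji : rj * c < tj * φji := by linarith
    exact ⟨0, c, ri + c * rj, rj, le_rfl, zero_le_one, hc₀, hc₁, by ring, rfl, by ring,
      by linarith, by linarith, hij, hji, fun _ _ hD hD' => add_lt_add (hD hij) (hD' hji)⟩
end

section
/- Let y(1),…,y(n) ∈ [0,1] and define the cumulative sums S_0 = 0 and S_k = S_{k−1} + y(k) for k = 1,…,n. For t ∈ [0,1), define P(t) = { k : there exists a nonnegative integer m with S_{k−1} ≤ t + m < S_k }. Then for each item k, the Lebesgue measure of the set { t ∈ [0,1) : k ∈ P(t) } equals y(k); equivalently, if t is drawn uniformly at random from [0,1), item k is included in P(t) with probability exactly y(k). -/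
open Finset

/-- Wrapping `[a, b)` with `0 ≤ a` and length at most one around the unit interval yields two
disjoint intervals. -/
theorem setOf_wrap_Ico_eq_union {a b : ℝ} (ha : 0 ≤ a) (hba : b ≤ a + 1) :
    {t : ℝ | t ∈ Set.Ico (0 : ℝ) 1 ∧ ∃ m : ℕ, a ≤ t + m ∧ t + m < b} =
      Set.Ico (a - ⌊a⌋₊) (min (b - ⌊a⌋₊) 1) ∪ Set.Ico 0 (b - ⌊a⌋₊ - 1) := by
  have h₁ := Nat.floor_le ha
  have h₂ := Nat.lt_floor_add_one a
  ext t
  simp only [Set.mem_ofPred_eq, Set.mem_Ico, Set.mem_union, lt_min_iff]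
  constructor
  · rintro ⟨⟨h0, h1⟩, m, hm, hm'⟩
    have hl : ⌊a⌋₊ < m + 1 := by
      rify
      linarith
    have hu : m < ⌊a⌋₊ + 2 := by
      rify
      linarith
    obtain rfl | rfl : m = ⌊a⌋₊ ∨ m = ⌊a⌋₊ + 1 := by omega
    · exact Or.inl ⟨by linarith, by linarith, h1⟩
    · push_cast at hm'
      exact Or.inr ⟨h0, by linarith⟩
  · rintro (⟨h, h', h1⟩ | ⟨h0, h⟩)
    · exact ⟨⟨by linarith, h1⟩, ⌊a⌋₊, by linarith, by linarith⟩
    · refine ⟨⟨h0, by linarith⟩, ⌊a⌋₊ + 1, ?_, ?_⟩ <;> push_cast <;> linarith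

/-- Wrapping an interval of length at most one around the unit interval preserves its length. -/
theorem volume_setOf_wrap_Ico {a b : ℝ} (ha : 0 ≤ a) (hba : b ≤ a + 1) :
    MeasureTheory.volume
        {t : ℝ | t ∈ Set.Ico (0 : ℝ) 1 ∧ ∃ m : ℕ, a ≤ t + m ∧ t + m < b} =
      ENNReal.ofReal (b - a) := by
  have h₂ := Nat.lt_floor_add_one a
  have hd : Disjoint (Set.Ico (a - ⌊a⌋₊) (min (b - ⌊a⌋₊) 1)) (Set.Ico 0 (b - ⌊a⌋₊ - 1)) := by
    rw [Set.disjoint_left]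
    rintro t ⟨h, -⟩ ⟨-, h'⟩
    linarith
  rw [setOf_wrap_Ico_eq_union ha hba, MeasureTheory.measure_union hd measurableSet_Ico,
    Real.volume_Ico, Real.volume_Ico]
  rcases le_total (b - ⌊a⌋₊) 1 with h | h
  · rw [min_eq_left h, ENNReal.ofReal_of_nonpos (by linarith : b - ⌊a⌋₊ - 1 - 0 ≤ 0), add_zero]
    congr 1
    ring
  · rw [min_eq_right h, ← ENNReal.ofReal_add (by linarith) (by linarith)]
    congr 1
    ring

/-- in the DRR bar-coloring rounding, for a uniformly random position
`t ∈ [0,1)`, each item `k` is included in `P(t)` with probability exactly `y k`: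
the set of positions selecting item `k` has Lebesgue measure `y k`. -/
theorem drr_inclusion_probability
    (n : ℕ) (y : ℕ → ℝ) (hy : ∀ k < n, 0 ≤ y k ∧ y k ≤ 1) :
    ∀ k < n,
      MeasureTheory.volume {t : ℝ | t ∈ Set.Ico (0 : ℝ) 1 ∧
          ∃ m : ℕ, (∑ l ∈ Finset.range k, y l) ≤ t + m ∧
            t + m < ∑ l ∈ Finset.range (k + 1), y l}
        = ENNReal.ofReal (y k) := by
  intro k hk
  have hs : 0 ≤ ∑ l ∈ Finset.range k, y l :=
    Finset.sum_nonneg fun l hl => (hy l ((Finset.mem_range.mp hl).trans hk)).1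
  obtain ⟨h0, h1⟩ := hy k hk
  rw [Finset.sum_range_succ, volume_setOf_wrap_Ico hs (by linarith),
    add_sub_cancel_left]
end

section
/- Let y(1),…,y(n) ∈ [0,1], define S_0 = 0, S_k = S_{k−1} + y(k), and S = S_n = Σ_{k=1}^n y(k). For t ∈ [0,1), let P(t) = { k : there exists a nonnegative integer m with S_{k−1} ≤ t + m < S_k }. Then for every t ∈ [0,1), the cardinality of P(t) differs from S by strictly less than 1: | |P(t)| − S | < 1. -/
open Finset

open Classical in
theorem ncard_setOf_lt_and_eq_count (p : ℕ → Prop) (n : ℕ) :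
    {k | k < n ∧ p k}.ncard = Nat.count p n := by
  rw [Nat.count_eq_card_filter_range, ← Set.ncard_coe_finset]
  congr 1
  ext k
  simp

/-- A half-open interval `[a, b)` meets the translates `t + m` of a position `t` iff the ceiling of
`a - t` is below `b - t`. -/
theorem exists_le_add_natCast_lt_iff {a b t : ℝ} (ha : 0 ≤ a) (ht : t < 1) :
    (∃ m : ℕ, a ≤ t + m ∧ t + m < b) ↔ (⌈a - t⌉ : ℝ) < b - t := by
  constructor
  · rintro ⟨m, hm, hmb⟩
    have h : ⌈a - t⌉ ≤ (m : ℤ) := Int.ceil_le.2 (by push_cast; linarith)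
    have h' : (⌈a - t⌉ : ℝ) ≤ m := by exact_mod_cast h
    linarith
  · intro h
    have hnonneg : 0 ≤ ⌈a - t⌉ := by
      have : -1 < ⌈a - t⌉ := Int.lt_ceil.2 (by push_cast; linarith)
      omega
    obtain ⟨m, hm⟩ := Int.eq_ofNat_of_zero_le hnonneg
    have hle := Int.le_ceil (a - t)
    rw [hm] at h hle
    push_cast at h hle
    exact ⟨m, by linarith, by linarith⟩

open Classical in
theorem count_bars_eq_ceil (n : ℕ) (y : ℕ → ℝ) (hy : ∀ k < n, 0 ≤ y k ∧ y k ≤ 1)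
    {t : ℝ} (h0 : 0 ≤ t) (h1 : t < 1) :
    (Nat.count (fun k => ∃ m : ℕ, (∑ l ∈ Finset.range k, y l) ≤ t + m ∧
      t + m < ∑ l ∈ Finset.range (k + 1), y l) n : ℤ) =
      ⌈(∑ l ∈ Finset.range n, y l) - t⌉ := by
  induction n with
  | zero =>
    symm
    simp only [Nat.count_zero, Finset.range_zero, Finset.sum_empty, Int.ceil_eq_iff]
    constructor <;> push_cast <;> linarith
  | succ n ih =>
    have hS : 0 ≤ ∑ l ∈ Finset.range n, y l :=
      Finset.sum_nonneg fun l hl => (hy l (by have := Finset.mem_range.1 hl; omega)).1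
    obtain ⟨hyn, hyn'⟩ := hy n n.lt_succ_self
    rw [Nat.count_succ, Nat.cast_add, ih fun k hk => hy k (hk.trans n.lt_succ_self),
      if_congr (exists_le_add_natCast_lt_iff hS h1) rfl rfl, Finset.sum_range_succ]
    have hle := Int.le_ceil (∑ l ∈ Finset.range n, y l - t)
    have hlt := Int.ceil_lt_add_one (∑ l ∈ Finset.range n, y l - t)
    symm
    rw [Int.ceil_eq_iff]
    split_ifs <;> constructor <;> push_cast <;> linarith

/-- in the DRR bar-coloring rounding, for every position `t ∈ [0,1)` the
number of cached items `|P(t)|` differs from the fractional cache size `S = ∑_k y k` by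
strictly less than `1`. -/
theorem drr_cache_size_bound
    (n : ℕ) (y : ℕ → ℝ) (hy : ∀ k < n, 0 ≤ y k ∧ y k ≤ 1) :
    ∀ t : ℝ, 0 ≤ t → t < 1 →
      |(({k | k < n ∧ ∃ m : ℕ, (∑ l ∈ Finset.range k, y l) ≤ t + m ∧
            t + m < ∑ l ∈ Finset.range (k + 1), y l}.ncard : ℝ))
          - ∑ l ∈ Finset.range n, y l| < 1 := by
  intro t h0 h1
  rw [ncard_setOf_lt_and_eq_count]
  have h := count_bars_eq_ceil n y hy h0 h1
  rw [eq_comm, Int.ceil_eq_iff] at h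
  obtain ⟨hlt, hle⟩ := h
  push_cast at hlt hle
  rw [abs_lt]
  constructor <;> linarith
end
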